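/- Let O be an orbit of the W_J-action on W and let v ∈ O. Then v is a minimal element of O with respect to the restriction to O of the Bruhat order on W if and only if v is an element of minimal length in O. -/

import Mathlib

namespace HePaper

variable {I : Type*} {M : CoxeterMatrix I} {W : Type*} [Group W]

/-- The standard parabolic subgroup `W_J` generated by the simple reflections `s_j`, `j ∈ J`. -/
def parabolic (cs : CoxeterSystem M W) (J : Set I) : Subgroup W :=
  Subgroup.closure (cs.simple '' J)

/-- `W^J`, the set of minimal length coset representatives for `W/W_J`. -/
def minRight (cs : CoxeterSystem M W) (J : Set I) : Set W :=
  {w : W | ∀ j ∈ J, cs.length w < cs.length (w * cs.simple j)}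

/-- `^J W`, the set of minimal length coset representatives for `W_J\W`. -/
def minLeft (cs : CoxeterSystem M W) (J : Set I) : Set W :=
  {w : W | ∀ j ∈ J, cs.length w < cs.length (cs.simple j * w)}

/-- `Ad(u)(K) = {k ∈ I : s_k = u s_j u⁻¹ for some j ∈ K}`. -/
def AdSet (cs : CoxeterSystem M W) (u : W) (K : Set I) : Set I :=
  {k : I | ∃ j ∈ K, cs.simple k = u * cs.simple j * u⁻¹}

/-- Membership in the set `T(J, δ)` of sequences `(J_n, w_n)_{n ≥ 0}`. -/
def InT (cs : CoxeterSystem M W) (J : Set I) (δ : I ≃ I)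
    (Jseq : ℕ → Set I) (wseq : ℕ → W) : Prop :=
  Jseq 0 = J ∧
  (∀ n : ℕ, Jseq (n + 1) = Jseq n ∩ AdSet cs (wseq n) (δ '' Jseq n)) ∧
  (∀ n : ℕ, wseq n ∈ minLeft cs (Jseq n) ∩ minRight cs (δ '' Jseq n)) ∧
  (∀ n : ℕ, ∃ x ∈ parabolic cs (Jseq (n + 1)), ∃ y ∈ parabolic cs (δ '' Jseq n),
      wseq (n + 1) = x * wseq n * y)

/-- `I(J, δ; w)`: the largest subset `K ⊆ J` with `Ad(w)(K) = δ(K)`. -/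
def IJdw (cs : CoxeterSystem M W) (J : Set I) (δ : I ≃ I) (w : W) : Set I :=
  ⋃₀ {K : Set I | K ⊆ J ∧ AdSet cs w K = δ '' K}

/-- The orbit of `w` under the `W_J`-action `x · y = δ(x) y x⁻¹`. -/
def orbit (cs : CoxeterSystem M W) (J : Set I) (δW : W ≃* W) (w : W) : Set W :=
  {y : W | ∃ x ∈ parabolic cs J, y = δW x * w * x⁻¹}

/-- The set of elements of minimal length in the orbit of `w`. -/
def orbitMin (cs : CoxeterSystem M W) (J : Set I) (δW : W ≃* W) (w : W) : Set W :=
  {v ∈ orbit cs J δW w | ∀ u ∈ orbit cs J δW w, cs.length v ≤ cs.length u}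

/-- `w →_{s_j} w'` for some `j ∈ J`: `w' = s_{δ(j)} w s_j` and `ℓ(w') ≤ ℓ(w)`. -/
def stepTo (cs : CoxeterSystem M W) (J : Set I) (δ : I ≃ I) (w w' : W) : Prop :=
  ∃ j ∈ J, w' = cs.simple (δ j) * w * cs.simple j ∧ cs.length w' ≤ cs.length w

/-- `w →_{J,δ} w'`. -/
def toRel (cs : CoxeterSystem M W) (J : Set I) (δ : I ≃ I) : W → W → Prop :=
  Relation.ReflTransGen (stepTo cs J δ)

/-- `w` and `w'` are elementarily strongly `(J, δ)`-conjugate. -/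
def ElemStrong (cs : CoxeterSystem M W) (J : Set I) (δW : W ≃* W) (w w' : W) : Prop :=
  cs.length w = cs.length w' ∧
  ∃ x ∈ parabolic cs J, w' = δW x * w * x⁻¹ ∧
    (cs.length (δW x * w) = cs.length x + cs.length w ∨
     cs.length (w * x⁻¹) = cs.length x + cs.length w)

/-- `w ∼_{J,δ} w'`: strongly `(J, δ)`-conjugate. -/
def simRel (cs : CoxeterSystem M W) (J : Set I) (δW : W ≃* W) : W → W → Prop :=
  Relation.ReflTransGen (ElemStrong cs J δW)

/-- The Bruhat order on `W`: some reduced word for `w` contains a subword that is a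
reduced word for `u`. -/
def bruhatLE (cs : CoxeterSystem M W) (u w : W) : Prop :=
  ∃ ω : List I, cs.wordProd ω = w ∧ cs.IsReduced ω ∧
    ∃ ω' : List I, ω'.Sublist ω ∧ cs.wordProd ω' = u ∧ cs.IsReduced ω'

/-- `supp(w)`: the smallest subset `K ⊆ I` with `w ∈ W_K`. -/
def supp (cs : CoxeterSystem M W) (w : W) : Set I :=
  ⋂₀ {K : Set I | w ∈ parabolic cs K}

/-- `supp_δ(w)`: the smallest `δ`-stable subset of `I` containing `supp(w)`. -/
def suppDelta (cs : CoxeterSystem M W) (δ : I ≃ I) (w : W) : Set I :=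
  ⋃ n : ℕ, (⇑δ)^[n] '' supp cs w

/-- `w ≤_{J,δ} w'` for `w, w' ∈ W^J`. -/
def leJd (cs : CoxeterSystem M W) (J : Set I) (δW : W ≃* W) (w w' : W) : Prop :=
  ∀ v' ∈ orbitMin cs J δW w', ∃ v ∈ orbitMin cs J δW w, bruhatLE cs v v'

section Geometry

open Polynomial.Chebyshev in
/-- The composite of two reflections whose roots meet at the angle `π - π / m` has order
dividing `m`. -/
lemma reflection_mul_reflection_pow_eq_one {V : Type*} [AddCommGroup V] [Module ℝ V] {x y : V}
    {f g : Module.Dual ℝ V} (hf : f x = 2) (hg : g y = 2) {m : ℕ} (hm : 2 ≤ m)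
    (hfy : f y = -2 * Real.cos (Real.pi / m)) (hgx : g x = -2 * Real.cos (Real.pi / m)) :
    (Module.reflection hf * Module.reflection hg) ^ m = 1 := by
  ext z
  rw [Module.reflection_mul_reflection_pow_apply hf hg m z]
  simp only [LinearEquiv.coe_one, id_eq]
  rcases hm.eq_or_lt with rfl | hm3
  · have h0 : Real.cos (Real.pi / (2 : ℕ)) = 0 := by simp
    rw [hfy, hgx, h0]
    norm_num
    module
  set φ : ℝ := 2 * Real.pi / m with hφ
  have hmpos : (0 : ℝ) < m := by positivity
  have ht : f y * g x - 2 = 2 * Real.cos φ := by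
    rw [hfy, hgx, hφ, show 2 * Real.pi / m = 2 * (Real.pi / m) by ring, Real.cos_two_mul]
    ring
  have hsin : Real.sin φ ≠ 0 := by
    apply ne_of_gt
    apply Real.sin_pos_of_pos_of_lt_pi
    · positivity
    · rw [hφ, div_lt_iff₀ hmpos]
      have : (3 : ℝ) ≤ m := by exact_mod_cast hm3
      nlinarith [Real.pi_pos]
  have hS : ∀ n : ℤ, (S ℝ n).eval (2 * Real.cos φ) = Real.sin ((n + 1) * φ) / Real.sin φ := by
    intro n
    rw [eq_div_iff hsin, S_two_mul_real_cos]
  rw [ht]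
  obtain ⟨k, rfl | rfl⟩ := Nat.even_or_odd' m
  · have e1 : (((2 * k : ℕ) : ℤ) - 2) / 2 = k - 1 := by omega
    have e2 : (((2 * k : ℕ) : ℤ) - 1) / 2 = k - 1 := by omega
    have hz : (S ℝ ((k : ℤ) - 1)).eval (2 * Real.cos φ) = 0 := by
      rw [hS]
      have : (((k : ℤ) - 1 : ℤ) + 1 : ℝ) * φ = Real.pi := by
        rw [hφ]; push_cast at hmpos ⊢
        have : (k : ℝ) ≠ 0 := by intro h; rw [h] at hmpos; simp at hmpos
        field_simp; ring
      rw [this]; simp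
    rw [e1, e2, hz]; simp
  · have e1 : (((2 * k + 1 : ℕ) : ℤ) - 2) / 2 = k - 1 := by omega
    have e2 : (((2 * k + 1 : ℕ) : ℤ) - 1) / 2 = k := by omega
    have e3 : (((2 * k + 1 : ℕ) : ℤ) - 3) / 2 = k - 1 := by omega
    have e4 : (((2 * k + 1 : ℕ) : ℤ)) / 2 = k := by omega
    have hz : (S ℝ (k : ℤ)).eval (2 * Real.cos φ) +
        (S ℝ ((k : ℤ) - 1)).eval (2 * Real.cos φ) = 0 := by
      rw [hS, hS, ← add_div]
      have h1 : (((k : ℤ) : ℝ) + 1) * φ = 2 * Real.pi - (((k : ℤ) - 1 : ℤ) + 1 : ℝ) * φ := by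
        rw [hφ]; push_cast at hmpos ⊢
        have : (2 * k + 1 : ℝ) ≠ 0 := hmpos.ne'
        field_simp; ring
      rw [h1, Real.sin_two_pi_sub]; simp
    rw [e1, e2, e3, e4, hz]; simp

variable [Fintype I] [DecidableEq I]

/-- The Gram matrix of the standard geometric representation. -/
noncomputable def gram (M : CoxeterMatrix I) : Matrix I I ℝ :=
  Matrix.of fun i j => -Real.cos (Real.pi / M i j)

/-- The symmetric bilinear form of the standard geometric representation. -/
noncomputable def form (M : CoxeterMatrix I) : LinearMap.BilinForm ℝ (I → ℝ) :=
  Matrix.toBilin' (gram M)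

/-- The simple roots of the standard geometric representation. -/
def simpleRoot (i : I) : I → ℝ := Pi.single i 1

lemma form_simpleRoot (i j : I) :
    form M (simpleRoot i) (simpleRoot j) = -Real.cos (Real.pi / M i j) := by
  simp [form, simpleRoot, Matrix.toBilin'_single, gram]

lemma form_simpleRoot_self (i : I) : form M (simpleRoot i) (simpleRoot i) = 1 := by
  simp [form_simpleRoot]

lemma form_comm (v w : I → ℝ) : form M v w = form M w v := by
  simp only [form, Matrix.toBilin'_apply]
  rw [Finset.sum_comm]
  refine Finset.sum_congr rfl fun i _ => Finset.sum_congr rfl fun j _ => ?_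
  simp only [gram, Matrix.of_apply, M.symmetric i j]
  ring

lemma eq_sum_simpleRoot (v : I → ℝ) : v = ∑ i, v i • simpleRoot i := by
  ext j
  simp [simpleRoot, Finset.sum_apply, Pi.single_apply]

lemma two_smul_form_self (i : I) :
    ((2 : ℝ) • form M (simpleRoot i) : Module.Dual ℝ (I → ℝ)) (simpleRoot i) = 2 := by
  simp [form_simpleRoot_self]

lemma isLiftable_reflection :
    M.IsLiftable (fun i => Module.reflection (two_smul_form_self (M := M) i)) := by
  intro i j
  rcases eq_or_ne i j with rfl | hij
  · rw [M.diagonal, pow_one]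
    ext v
    simp [LinearEquiv.mul_apply, Module.involutive_reflection (two_smul_form_self (M := M) i) v]
  · rcases Nat.eq_zero_or_pos (M i j) with h | h
    · rw [h, pow_zero]
    · have h1 := M.off_diagonal i j hij
      apply reflection_mul_reflection_pow_eq_one _ _ (by omega : 2 ≤ M i j)
      · simp [form_simpleRoot]
      · simp [form_simpleRoot, M.symmetric j i]

/-- The standard geometric representation of a Coxeter group. -/
noncomputable def geomRep (cs : CoxeterSystem M W) : W →* ((I → ℝ) ≃ₗ[ℝ] (I → ℝ)) :=
  cs.lift ⟨_, isLiftable_reflection⟩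

lemma geomRep_simple (cs : CoxeterSystem M W) (i : I) (v : I → ℝ) :
    geomRep cs (cs.simple i) v = v - (2 * form M (simpleRoot i) v) • simpleRoot i := by
  rw [geomRep, cs.lift_apply_simple, Module.reflection_apply]
  simp

lemma geomRep_mul_apply (cs : CoxeterSystem M W) (x y : W) (v : I → ℝ) :
    geomRep cs (x * y) v = geomRep cs x (geomRep cs y v) := by
  rw [map_mul]; rfl

lemma geomRep_one_apply (cs : CoxeterSystem M W) (v : I → ℝ) : geomRep cs 1 v = v := by
  rw [map_one]; rfl

lemma geomRep_inv_apply_self (cs : CoxeterSystem M W) (x : W) (v : I → ℝ) :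
    geomRep cs x⁻¹ (geomRep cs x v) = v := by
  rw [← geomRep_mul_apply, inv_mul_cancel, geomRep_one_apply]

lemma geomRep_apply_inv_self (cs : CoxeterSystem M W) (x : W) (v : I → ℝ) :
    geomRep cs x (geomRep cs x⁻¹ v) = v := by
  rw [← geomRep_mul_apply, mul_inv_cancel, geomRep_one_apply]

lemma geomRep_simple_self (cs : CoxeterSystem M W) (i : I) :
    geomRep cs (cs.simple i) (simpleRoot i) = -simpleRoot i := by
  rw [geomRep_simple, form_simpleRoot_self]
  module

lemma form_geomRep (cs : CoxeterSystem M W) (x : W) (v w : I → ℝ) :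
    form M (geomRep cs x v) (geomRep cs x w) = form M v w := by
  induction x using cs.simple_induction_left generalizing v w with
  | one => simp only [geomRep_one_apply]
  | mul_simple_left x i ih =>
    rw [geomRep_mul_apply, geomRep_mul_apply, ← ih v w, geomRep_simple, geomRep_simple]
    simp only [map_sub, map_smul, LinearMap.sub_apply, LinearMap.smul_apply, smul_eq_mul,
      form_simpleRoot_self, form_comm _ (simpleRoot i)]
    ring

lemma form_geomRep_left (cs : CoxeterSystem M W) (x : W) (v w : I → ℝ) :
    form M (geomRep cs x v) w = form M v (geomRep cs x⁻¹ w) := by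
  rw [← form_geomRep cs x v, geomRep_apply_inv_self]

/-- The coefficients of the roots of a dihedral group. -/
lemma geomRep_alternatingWord (cs : CoxeterSystem M W) (i j : I) (c : ℕ → ℝ) (hc0 : c 0 = 0)
    (hc1 : c 1 = 1)
    (hc : ∀ k, c (k + 2) = 2 * Real.cos (Real.pi / M i j) * c (k + 1) - c k) (k : ℕ) :
    geomRep cs (cs.wordProd (CoxeterSystem.alternatingWord i j k)) (simpleRoot i) =
      if Even k then c (k + 1) • simpleRoot i + c k • simpleRoot j
      else c (k + 1) • simpleRoot j + c k • simpleRoot i := by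
  induction k with
  | zero => simp [CoxeterSystem.alternatingWord, hc0, hc1]
  | succ k ih =>
    rw [CoxeterSystem.alternatingWord_succ', cs.wordProd_cons, geomRep_mul_apply, ih]
    by_cases hk : Even k
    · have hk' : ¬ Even (k + 1) := by simpa [Nat.even_add_one] using hk
      simp only [hk, hk', if_true, if_false, map_add, map_smul, geomRep_simple,
        form_simpleRoot, M.diagonal, Nat.cast_one, div_one, Real.cos_pi, hc, M.symmetric j i]
      module
    · have hk' : Even (k + 1) := by simpa [Nat.even_add_one] using hk
      simp only [hk, hk', if_true, if_false, map_add, map_smul, geomRep_simple,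
        form_simpleRoot, M.diagonal, Nat.cast_one, div_one, Real.cos_pi, hc]
      module

lemma exists_dihedral_coefficients (m : ℕ) (hm1 : m ≠ 1) :
    ∃ c : ℕ → ℝ, c 0 = 0 ∧ c 1 = 1 ∧
      (∀ k, c (k + 2) = 2 * Real.cos (Real.pi / m) * c (k + 1) - c k) ∧
      ∀ k, (m = 0 ∨ k ≤ m) → 0 ≤ c k := by
  rcases Nat.eq_zero_or_pos m with rfl | hm
  · refine ⟨fun k => k, by simp, by simp, fun k => ?_, fun k _ => by positivity⟩
    simp; ring
  have hmR : (2 : ℝ) ≤ m := by exact_mod_cast (by omega : 2 ≤ m)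
  set θ : ℝ := Real.pi / m with hθ
  have hmθ : m * θ = Real.pi := by rw [hθ]; field_simp
  have hθpos : 0 < θ := by positivity
  have hsin : 0 < Real.sin θ := by
    apply Real.sin_pos_of_pos_of_lt_pi hθpos
    nlinarith [Real.pi_pos]
  refine ⟨fun k => Real.sin (k * θ) / Real.sin θ, by simp, ?_, fun k => ?_, fun k hk => ?_⟩
  · simp [hsin.ne']
  · have e1 : ((k + 2 : ℕ) : ℝ) * θ = (k + 1 : ℕ) * θ + θ := by push_cast; ring
    have e2 : (k : ℝ) * θ = (k + 1 : ℕ) * θ - θ := by push_cast; ring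
    beta_reduce
    rw [e1, e2, Real.sin_add, Real.sin_sub]
    ring
  · apply div_nonneg _ hsin.le
    apply Real.sin_nonneg_of_nonneg_of_le_pi (by positivity)
    rw [← hmθ]
    have : (k : ℝ) ≤ m := by
      rcases hk with h | h
      · omega
      · exact_mod_cast h
    gcongr

/-- If `ℓ(w) < ℓ(w s_i)` then `w` sends the simple root `α_i` to a nonnegative vector. -/
theorem geomRep_simpleRoot_nonneg (cs : CoxeterSystem M W) (w : W) (i : I)
    (h : cs.length w < cs.length (w * cs.simple i)) :
    0 ≤ geomRep cs w (simpleRoot i) := by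
  induction hn : cs.length w using Nat.strong_induction_on generalizing w i with
  | _ n IH =>
  subst hn
  have hsr : ∀ i : I, (0 : I → ℝ) ≤ simpleRoot i := fun i => by
    simp [simpleRoot, Pi.single_nonneg]
  by_cases hw : w = 1
  · rw [hw, geomRep_one_apply]; exact hsr i
  obtain ⟨j, hj⟩ := cs.exists_rightDescent_of_ne_one hw
  have hij : i ≠ j := by
    rintro rfl
    exact absurd h (not_lt.mpr (le_of_lt hj))
  let Q : ℕ → Prop := fun k => ∃ v, w = v * cs.wordProd (CoxeterSystem.alternatingWord i j k) ∧
    cs.length v + k = cs.length w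
  have hQ1 : Q 1 := ⟨w * cs.simple j, by simp [CoxeterSystem.alternatingWord],
    cs.isRightDescent_iff.mp hj⟩
  have hQsucc : ∀ k, Q (k + 1) → Q k := by
    rintro k ⟨v, hv, hl⟩
    refine ⟨v * cs.simple (if Even k then j else i), ?_, ?_⟩
    · rw [hv, CoxeterSystem.alternatingWord_succ', cs.wordProd_cons, mul_assoc]
    · have h1 : cs.length w ≤ cs.length (v * cs.simple (if Even k then j else i)) + k := by
        conv_lhs => rw [hv, CoxeterSystem.alternatingWord_succ', cs.wordProd_cons, ← mul_assoc]
        refine (cs.length_mul_le _ _).trans ?_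
        gcongr
        refine (cs.length_wordProd_le _).trans ?_
        simp
      have h2 := cs.length_mul_simple v (if Even k then j else i)
      omega
  have hQm : M i j ≠ 0 → ¬ Q (M i j) := by
    rintro hm ⟨v, hv, hl⟩
    have hb := cs.wordProd_braidWord_eq i j
    rw [CoxeterSystem.braidWord, CoxeterSystem.braidWord, M.symmetric j i] at hb
    obtain ⟨m, hm'⟩ := Nat.exists_eq_succ_of_ne_zero hm
    rw [hb, hm', Nat.succ_eq_add_one, CoxeterSystem.alternatingWord_succ, cs.wordProd_concat,
      ← mul_assoc] at hv
    have : w * cs.simple i = v * cs.wordProd (CoxeterSystem.alternatingWord i j m) := by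
      rw [hv, mul_assoc, mul_assoc, cs.simple_mul_simple_self, mul_one]
    have h1 : cs.length (w * cs.simple i) ≤ cs.length v + m := by
      rw [this]
      refine (cs.length_mul_le _ _).trans ?_
      gcongr
      refine (cs.length_wordProd_le _).trans ?_
      simp
    omega
  have hbd : ∀ k, Q k → k ≤ cs.length w := by rintro k ⟨v, -, hl⟩; omega
  obtain ⟨k, hk1, hQk, hQk'⟩ : ∃ k, 1 ≤ k ∧ Q k ∧ ¬ Q (k + 1) := by
    by_contra! hcon
    have : ∀ k, 1 ≤ k → Q k := fun k hk => Nat.le_induction hQ1 (fun n hn hq => hcon n hn hq) k hk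
    have := hbd _ (this (cs.length w + 1) (by omega))
    omega
  have hkm : M i j = 0 ∨ k + 1 ≤ M i j := by
    by_contra! hcon
    have hdown : ∀ d, ∀ l, Q (l + d) → Q l := by
      intro d
      induction d with
      | zero => intro l h; exact h
      | succ d ih => intro l h; exact ih l (hQsucc _ h)
    refine hQm hcon.1 (hdown (k - M i j) _ ?_)
    rwa [Nat.add_sub_cancel' (by omega)]
  obtain ⟨v, hv, hl⟩ := hQk
  have hvi : ∀ a, a = i ∨ a = j → cs.length v < cs.length (v * cs.simple a) := by
    intro a ha
    rcases cs.length_mul_simple v a with h1 | h1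
    · omega
    exfalso
    by_cases hf : a = (if Even k then j else i)
    · apply hQk'
      refine ⟨v * cs.simple a, ?_, by omega⟩
      rw [CoxeterSystem.alternatingWord_succ', cs.wordProd_cons, ← hf, ← mul_assoc,
        mul_assoc v, cs.simple_mul_simple_self, mul_one, hv]
    · obtain ⟨k, rfl⟩ := Nat.exists_eq_add_of_le' hk1
      have hf' : a = (if Even k then j else i) := by
        by_cases hk : Even k <;> simp_all [Nat.even_add_one]
      have : w = v * cs.simple a * cs.wordProd (CoxeterSystem.alternatingWord i j k) := by
        rw [hv, CoxeterSystem.alternatingWord_succ', cs.wordProd_cons, ← hf', ← mul_assoc]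
      have h2 : cs.length w ≤ cs.length (v * cs.simple a) + k := by
        conv_lhs => rw [this]
        refine (cs.length_mul_le _ _).trans ?_
        gcongr
        refine (cs.length_wordProd_le _).trans ?_
        simp
      omega
  have hpi := IH _ (by omega) v i (hvi i (Or.inl rfl)) rfl
  have hpj := IH _ (by omega) v j (hvi j (Or.inr rfl)) rfl
  obtain ⟨c, hc0, hc1, hc, hcpos⟩ := exists_dihedral_coefficients (M i j) (M.off_diagonal i j hij)
  have hck : 0 ≤ c k := hcpos k (by omega)
  have hck1 : 0 ≤ c (k + 1) := hcpos (k + 1) hkm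
  rw [hv, geomRep_mul_apply, geomRep_alternatingWord cs i j c hc0 hc1 hc]
  split_ifs
  all_goals
    rw [map_add, map_smul, map_smul]
    exact add_nonneg (smul_nonneg hck1 (by assumption)) (smul_nonneg hck (by assumption))

theorem geomRep_simpleRoot_nonpos (cs : CoxeterSystem M W) (w : W) (i : I)
    (h : cs.length (w * cs.simple i) < cs.length w) :
    geomRep cs w (simpleRoot i) ≤ 0 := by
  have h1 := geomRep_simpleRoot_nonneg cs (w * cs.simple i) i (by
    rwa [mul_assoc, cs.simple_mul_simple_self, mul_one])
  rw [geomRep_mul_apply, geomRep_simple_self, map_neg] at h1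
  exact neg_nonneg.mp h1

lemma geomRep_simpleRoot_ne_zero (cs : CoxeterSystem M W) (w : W) (i : I) :
    geomRep cs w (simpleRoot i) ≠ 0 := by
  rw [Ne, LinearEquiv.map_eq_zero_iff]
  simp [simpleRoot]

lemma length_lt_iff_nonneg (cs : CoxeterSystem M W) (w : W) (i : I) :
    cs.length w < cs.length (w * cs.simple i) ↔ 0 ≤ geomRep cs w (simpleRoot i) := by
  refine ⟨geomRep_simpleRoot_nonneg cs w i, fun h => ?_⟩
  by_contra hcon
  have h1 := geomRep_simpleRoot_nonpos cs w i
    (lt_of_le_of_ne (not_lt.mp hcon) (cs.length_mul_simple_ne w i))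
  exact geomRep_simpleRoot_ne_zero cs w i (le_antisymm h1 h)

lemma geomRep_injective (cs : CoxeterSystem M W) : Function.Injective (geomRep cs) := by
  rw [injective_iff_map_eq_one]
  intro w hw
  by_contra hne
  obtain ⟨j, hj⟩ := cs.exists_rightDescent_of_ne_one hne
  have h1 := geomRep_simpleRoot_nonpos cs w j hj
  rw [hw] at h1
  have h2 : (simpleRoot j : I → ℝ) ≤ 0 := h1
  have := h2 j
  simp [simpleRoot] at this
  linarith

end Geometry

section Exchange

lemma length_wordProd_eraseIdx_lt (cs : CoxeterSystem M W) (ω : List I) {r : ℕ}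
    (hr : r < ω.length) : cs.length (cs.wordProd (ω.eraseIdx r)) < ω.length := by
  refine (cs.length_wordProd_le _).trans_lt ?_
  rw [List.length_eraseIdx_of_lt hr]
  omega

variable [Fintype I] [DecidableEq I]

lemma geomRep_nonneg_or_nonpos (cs : CoxeterSystem M W) (w : W) (i : I) :
    0 ≤ geomRep cs w (simpleRoot i) ∨ geomRep cs w (simpleRoot i) ≤ 0 := by
  rcases lt_or_gt_of_ne (cs.length_mul_simple_ne w i) with h | h
  · exact Or.inr (geomRep_simpleRoot_nonpos cs w i h)
  · exact Or.inl (geomRep_simpleRoot_nonneg cs w i h)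

lemma geomRep_not_nonneg_and_nonpos (cs : CoxeterSystem M W) (w : W) (i : I)
    (h1 : 0 ≤ geomRep cs w (simpleRoot i)) (h2 : geomRep cs w (simpleRoot i) ≤ 0) : False :=
  geomRep_simpleRoot_ne_zero cs w i (le_antisymm h2 h1)

/-- The only positive root made negative by `s_a` is `α_a`. -/
lemma geomRep_eq_simpleRoot (cs : CoxeterSystem M W) (w : W) (i a : I)
    (h1 : 0 ≤ geomRep cs w (simpleRoot i))
    (h2 : geomRep cs (cs.simple a * w) (simpleRoot i) ≤ 0) :
    geomRep cs w (simpleRoot i) = simpleRoot a := by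
  set v := geomRep cs w (simpleRoot i) with hv
  rw [geomRep_mul_apply, ← hv, geomRep_simple] at h2
  have hva : v = v a • simpleRoot a := by
    ext b
    rcases eq_or_ne b a with rfl | hb
    · simp [simpleRoot]
    · have e1 := h1 b
      have e2 := h2 b
      simp [simpleRoot, hb] at e1 e2 ⊢
      linarith
  have hn : form M v v = 1 := by rw [hv, form_geomRep, form_simpleRoot_self]
  rw [hva] at hn
  simp only [map_smul, LinearMap.smul_apply, form_simpleRoot_self, smul_eq_mul, mul_one] at hn
  have h0 : 0 ≤ v a := h1 a
  have : v a = 1 := by nlinarith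
  rw [hva, this, one_smul]

lemma geomRep_conj_simple (cs : CoxeterSystem M W) (y : W) (i : I) (z : I → ℝ) :
    geomRep cs (y * cs.simple i * y⁻¹) z =
      z - (2 * form M (geomRep cs y (simpleRoot i)) z) • geomRep cs y (simpleRoot i) := by
  rw [geomRep_mul_apply, geomRep_mul_apply, geomRep_simple, map_sub, map_smul,
    geomRep_apply_inv_self, form_geomRep_left]

lemma conj_simple_eq (cs : CoxeterSystem M W) (y : W) (i a : I)
    (h : geomRep cs y (simpleRoot i) = simpleRoot a) :
    y * cs.simple i * y⁻¹ = cs.simple a := by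
  apply geomRep_injective cs
  ext1 z
  rw [geomRep_conj_simple, h, geomRep_simple]

lemma root_exchange (cs : CoxeterSystem M W) (ω : List I) (x : W) (i : I)
    (h1 : 0 ≤ geomRep cs x (simpleRoot i))
    (h2 : geomRep cs (cs.wordProd ω * x) (simpleRoot i) ≤ 0) :
    ∃ r < ω.length, cs.wordProd ω * (x * cs.simple i * x⁻¹) = cs.wordProd (ω.eraseIdx r) := by
  induction ω with
  | nil =>
    rw [cs.wordProd_nil, one_mul] at h2
    exact (geomRep_not_nonneg_and_nonpos cs x i h1 h2).elim
  | cons a ω ih =>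
    rcases geomRep_nonneg_or_nonpos cs (cs.wordProd ω * x) i with h3 | h3
    · rw [cs.wordProd_cons, mul_assoc] at h2
      have h4 := conj_simple_eq cs _ i a (geomRep_eq_simpleRoot cs _ i a h3 h2)
      refine ⟨0, by simp, ?_⟩
      have h5 : cs.wordProd ω * (x * cs.simple i * x⁻¹) = cs.simple a * cs.wordProd ω := by
        rw [← h4]; group
      rw [cs.wordProd_cons, mul_assoc, h5, cs.simple_mul_simple_cancel_left]
      rfl
    · obtain ⟨r, hr, hr'⟩ := ih h3
      refine ⟨r + 1, by simpa using hr, ?_⟩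
      rw [cs.wordProd_cons, mul_assoc, hr', List.eraseIdx_cons_succ, cs.wordProd_cons]

theorem strong_exchange (cs : CoxeterSystem M W) (ω : List I) {t : W} (ht : cs.IsReflection t)
    (hlt : cs.length (cs.wordProd ω * t) < cs.length (cs.wordProd ω)) :
    ∃ r < ω.length, cs.wordProd ω * t = cs.wordProd (ω.eraseIdx r) := by
  obtain ⟨x, i, hpos, rfl⟩ : ∃ x i, 0 ≤ geomRep cs x (simpleRoot i) ∧
      t = x * cs.simple i * x⁻¹ := by
    obtain ⟨x, i, rfl⟩ := ht
    rcases geomRep_nonneg_or_nonpos cs x i with h | h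
    · exact ⟨x, i, h, rfl⟩
    · refine ⟨x * cs.simple i, i, ?_, ?_⟩
      · rw [geomRep_mul_apply, geomRep_simple_self, map_neg]
        exact neg_nonneg.mpr h
      · simp [mul_assoc]
  rcases geomRep_nonneg_or_nonpos cs (cs.wordProd ω * x) i with h | h
  · exfalso
    obtain ⟨τ, hτ, hτ'⟩ := cs.exists_isReduced (cs.wordProd ω * (x * cs.simple i * x⁻¹))
    obtain ⟨r, hr, hr'⟩ := root_exchange cs τ x i hpos (by
      rw [← hτ']
      have : cs.wordProd ω * (x * cs.simple i * x⁻¹) * x = cs.wordProd ω * x * cs.simple i := by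
        group
      rw [this, geomRep_mul_apply, geomRep_simple_self, map_neg]
      exact neg_nonpos.mpr h)
    have h1 : cs.wordProd (τ.eraseIdx r) = cs.wordProd ω := by
      rw [← hr', ← hτ']; simp [mul_assoc]
    have h2 := length_wordProd_eraseIdx_lt cs τ hr
    rw [h1, ← hτ, ← hτ'] at h2
    omega
  · exact root_exchange cs ω x i hpos h

end Exchange

section Bruhat

/-- A single step down in the reflection-chain description of the Bruhat order. -/
def reflStep (cs : CoxeterSystem M W) (x y : W) : Prop :=
  ∃ t, cs.IsReflection t ∧ x = y * t ∧ cs.length x < cs.length y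

/-- The Bruhat order described by chains of reflections. -/
def chainLE (cs : CoxeterSystem M W) : W → W → Prop := Relation.ReflTransGen (reflStep cs)

lemma reflStep_mul_simple (cs : CoxeterSystem M W) (w : W) (s : I)
    (h : cs.length w < cs.length (w * cs.simple s)) : reflStep cs w (w * cs.simple s) :=
  ⟨cs.simple s, cs.isReflection_simple s, by simp, h⟩

lemma IsReduced.of_append_singleton {cs : CoxeterSystem M W} {ω : List I} {s : I}
    (h : cs.IsReduced (ω ++ [s])) : cs.IsReduced ω := by
  simpa using h.take ω.length

variable [Fintype I] [DecidableEq I]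

lemma exists_reduced_sublist (cs : CoxeterSystem M W) (ω : List I) :
    ∃ τ : List I, τ.Sublist ω ∧ cs.wordProd τ = cs.wordProd ω ∧ cs.IsReduced τ := by
  induction ω with
  | nil => exact ⟨[], by simp, rfl, by simp [CoxeterSystem.IsReduced]⟩
  | cons a ω ih =>
    obtain ⟨τ, hτ, hτ', hr⟩ := ih
    rcases cs.length_simple_mul (cs.wordProd ω) a with h | h
    · refine ⟨a :: τ, hτ.cons_cons a, by simp [cs.wordProd_cons, hτ'], ?_⟩
      rw [CoxeterSystem.IsReduced, cs.wordProd_cons, hτ', h, ← hτ', hr.eq, List.length_cons]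
    · have ht : cs.IsReflection ((cs.wordProd τ)⁻¹ * cs.simple a * cs.wordProd τ) := by
        simpa using (cs.isReflection_simple a).conj (cs.wordProd τ)⁻¹
      have e : cs.wordProd τ * ((cs.wordProd τ)⁻¹ * cs.simple a * cs.wordProd τ) =
          cs.simple a * cs.wordProd ω := by rw [← hτ']; group
      obtain ⟨r, hr1, hr2⟩ := strong_exchange cs τ ht (by rw [e, hτ']; omega)
      refine ⟨τ.eraseIdx r, ((List.eraseIdx_sublist _ _).trans hτ).cons a, ?_, ?_⟩
      · rw [← hr2, e, cs.wordProd_cons]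
      · rw [CoxeterSystem.IsReduced, ← hr2, e, List.length_eraseIdx_of_lt hr1]
        have := hr.eq
        rw [hτ'] at this
        omega

lemma chainLE.exists_sublist {cs : CoxeterSystem M W} {u w : W} (h : chainLE cs u w) (ω : List I)
    (hω : cs.wordProd ω = w) : ∃ τ : List I, τ.Sublist ω ∧ cs.wordProd τ = u := by
  induction h using Relation.ReflTransGen.head_induction_on with
  | refl => exact ⟨ω, List.Sublist.refl _, hω⟩
  | head hxy _ ih =>
    obtain ⟨τ, hτ, rfl⟩ := ih
    obtain ⟨t, ht, rfl, hlt⟩ := hxy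
    obtain ⟨r, _, hr⟩ := strong_exchange cs τ ht hlt
    exact ⟨_, (List.eraseIdx_sublist _ _).trans hτ, hr.symm⟩

lemma reflStep.mul_simple {cs : CoxeterSystem M W} {x y : W} (h : reflStep cs x y) (s : I) :
    x * cs.simple s = y ∨ reflStep cs (x * cs.simple s) (y * cs.simple s) := by
  obtain ⟨t, ht, rfl, hlt⟩ := h
  by_cases hlt' : cs.length (y * t * cs.simple s) < cs.length (y * cs.simple s)
  · refine Or.inr ⟨cs.simple s * t * (cs.simple s)⁻¹, ht.conj _, ?_, hlt'⟩
    simp [mul_assoc]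
  left
  have h1 := cs.length_mul_simple (y * t) s
  have h2 := cs.length_mul_simple y s
  have hne : cs.length (y * t * cs.simple s) ≠ cs.length (y * cs.simple s) := by
    have := (ht.conj (cs.simple s)).length_mul_left_ne (y * cs.simple s)
    simpa [mul_assoc] using this
  obtain ⟨ω, hω, hω'⟩ := cs.exists_isReduced (y * cs.simple s)
  have hy : cs.wordProd (ω ++ [s]) = y := by
    rw [cs.wordProd_append, ← hω']; simp
  obtain ⟨r, hr, hr'⟩ := strong_exchange cs (ω ++ [s]) ht (by rwa [hy])
  rw [hy] at hr'
  have hωl := hω.eq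
  rw [← hω'] at hωl
  rcases lt_or_ge r ω.length with hrω | hrω
  · exfalso
    rw [List.eraseIdx_append_of_lt_length hrω, cs.wordProd_append] at hr'
    have e : y * t * cs.simple s = cs.wordProd (ω.eraseIdx r) := by rw [hr']; simp
    have := length_wordProd_eraseIdx_lt cs ω hrω
    rw [← e] at this
    omega
  · have hrr : r = ω.length := by simp at hr; omega
    subst hrr
    rw [List.eraseIdx_append_of_length_le le_rfl] at hr'
    simp only [Nat.sub_self, List.eraseIdx_cons_zero, List.append_nil] at hr'
    rw [hr', ← hω']
    simp

lemma chainLE.mul_simple {cs : CoxeterSystem M W} {x y : W} (h : chainLE cs x y) (s : I) :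
    chainLE cs (x * cs.simple s) y ∨ chainLE cs (x * cs.simple s) (y * cs.simple s) := by
  induction h using Relation.ReflTransGen.head_induction_on with
  | refl => exact Or.inr .refl
  | head hxy hyz ih =>
    rcases hxy.mul_simple s with h | h
    · rw [h]; exact Or.inl hyz
    · exact ih.imp (fun h' => .head h h') (fun h' => .head h h')

lemma chainLE_of_sublist (cs : CoxeterSystem M W) (ω τ : List I) (hω : cs.IsReduced ω)
    (hτ : τ.Sublist ω) : chainLE cs (cs.wordProd τ) (cs.wordProd ω) := by
  induction ω using List.reverseRecOn generalizing τ with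
  | nil => rw [List.sublist_nil.mp hτ]; exact .refl
  | append_singleton ω s ih =>
    have hω0 := IsReduced.of_append_singleton hω
    have hst : reflStep cs (cs.wordProd ω) (cs.wordProd ω * cs.simple s) := by
      apply reflStep_mul_simple
      have := hω.eq
      rw [cs.wordProd_append, cs.wordProd_singleton, List.length_append] at this
      rw [this, hω0.eq]
      simp
    obtain ⟨τ₁, τ₂, rfl, h1, h2⟩ := List.sublist_append_iff.mp hτ
    rw [cs.wordProd_append ω, cs.wordProd_singleton]
    rcases List.sublist_singleton.mp h2 with rfl | rfl
    · rw [List.append_nil]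
      exact (ih τ₁ hω0 h1).tail hst
    · rw [cs.wordProd_append, cs.wordProd_singleton]
      rcases (ih τ₁ hω0 h1).mul_simple s with h | h
      · exact h.tail hst
      · exact h

lemma bruhatLE_of_sublist (cs : CoxeterSystem M W) {ω τ : List I} (hω : cs.IsReduced ω)
    (hτ : τ.Sublist ω) : bruhatLE cs (cs.wordProd τ) (cs.wordProd ω) := by
  obtain ⟨τ', h1, h2, h3⟩ := exists_reduced_sublist cs τ
  exact ⟨ω, rfl, hω, τ', h1.trans hτ, h2, h3⟩

lemma bruhatLE.exists_sublist {cs : CoxeterSystem M W} {u w : W} (h : bruhatLE cs u w)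
    (ω : List I) (hω : cs.wordProd ω = w) :
    ∃ τ : List I, τ.Sublist ω ∧ cs.wordProd τ = u ∧ cs.IsReduced τ := by
  obtain ⟨ω₀, rfl, h1, τ₀, h2, rfl, -⟩ := h
  obtain ⟨τ, hτ, hprod⟩ := (chainLE_of_sublist cs ω₀ τ₀ h1 h2).exists_sublist ω hω
  obtain ⟨τ', h3, h4, h5⟩ := exists_reduced_sublist cs τ
  exact ⟨τ', h3.trans hτ, h4.trans hprod, h5⟩

/-- Bruhat lower bounds can be transported backwards along a cyclic shift that does not increase
the length. -/
theorem bruhatLE_transfer (cs : CoxeterSystem M W) (a s : I) (w u : W)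
    (hl : cs.length (cs.simple a * w * cs.simple s) ≤ cs.length w)
    (hu : bruhatLE cs u (cs.simple a * w * cs.simple s)) :
    bruhatLE cs u w ∨ (bruhatLE cs (cs.simple a * u * cs.simple s) w ∧
      cs.length (cs.simple a * u * cs.simple s) ≤ cs.length u) := by
  obtain ⟨w₁, rfl⟩ : ∃ w₁, w = cs.simple a * w₁ * cs.simple s :=
    ⟨cs.simple a * w * cs.simple s, by simp [mul_assoc]⟩
  have e : cs.simple a * (cs.simple a * w₁ * cs.simple s) * cs.simple s = w₁ := by
    simp [mul_assoc]
  rw [e] at hl hu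
  rcases cs.length_mul_simple w₁ s with h1 | h1
  · rcases cs.length_simple_mul w₁ a with h2 | h2
    · left
      obtain ⟨ω, hω, rfl⟩ := cs.exists_isReduced w₁
      obtain ⟨τ, hτ, rfl, hτr⟩ := hu.exists_sublist ω rfl
      rcases cs.length_mul_simple (cs.simple a * cs.wordProd ω) s with h3 | h3
      · have : cs.IsReduced (a :: (ω ++ [s])) := by
          rw [CoxeterSystem.IsReduced, cs.wordProd_cons, cs.wordProd_append,
            cs.wordProd_singleton, ← mul_assoc, h3, h2, hω.eq]
          simp
        have hb := bruhatLE_of_sublist cs this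
          ((hτ.trans (List.sublist_append_left ω [s])).cons a)
        rwa [cs.wordProd_cons, cs.wordProd_append, cs.wordProd_singleton, ← mul_assoc] at hb
      · obtain ⟨r, hr, hr'⟩ := strong_exchange cs (a :: ω) (cs.isReflection_simple s) (by
          rw [cs.wordProd_cons]; omega)
        rw [cs.wordProd_cons] at hr'
        cases r with
        | zero => rw [hr']; exact hu
        | succ r =>
          exfalso
          rw [List.eraseIdx_cons_succ, cs.wordProd_cons, mul_assoc] at hr'
          have := length_wordProd_eraseIdx_lt cs ω (r := r) (by simpa using hr)
          rw [← mul_left_cancel hr'] at this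
          have := hω.eq
          omega
    · obtain ⟨ω, hω, hω'⟩ := cs.exists_isReduced (cs.simple a * w₁)
      have hw₁ : cs.wordProd (a :: ω) = w₁ := by rw [cs.wordProd_cons, ← hω']; simp
      have hred : cs.IsReduced (ω ++ [s]) := by
        have h4 := cs.length_wordProd_le (ω ++ [s])
        have h5 := hω.eq
        rw [← hω'] at h5
        rw [CoxeterSystem.IsReduced]
        rw [cs.wordProd_append, cs.wordProd_singleton, ← hω'] at h4 ⊢
        simp only [List.length_append, List.length_singleton] at h4 ⊢
        omega
      have hw : cs.simple a * w₁ * cs.simple s = cs.wordProd (ω ++ [s]) := by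
        rw [hω', cs.wordProd_append, cs.wordProd_singleton]
      rw [hw]
      obtain ⟨τ, hτ, rfl, hτr⟩ := hu.exists_sublist (a :: ω) hw₁
      rcases List.sublist_cons_iff.mp hτ with h | ⟨τ₁, rfl, h⟩
      · exact Or.inl (bruhatLE_of_sublist cs hred (h.trans (List.sublist_append_left ω [s])))
      · right
        have e1 : cs.simple a * cs.wordProd (a :: τ₁) * cs.simple s =
            cs.wordProd (τ₁ ++ [s]) := by
          rw [cs.wordProd_cons, cs.wordProd_append, cs.wordProd_singleton]; simp
        rw [e1, hτr.eq]
        refine ⟨bruhatLE_of_sublist cs hred (h.append_right [s]), ?_⟩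
        refine (cs.length_wordProd_le _).trans (by simp)
  · obtain ⟨ω, hω, hω'⟩ := cs.exists_isReduced (w₁ * cs.simple s)
    have hw₁ : cs.wordProd (ω ++ [s]) = w₁ := by rw [cs.wordProd_append, ← hω']; simp
    have hred : cs.IsReduced (a :: ω) := by
      have h4 := cs.length_wordProd_le (a :: ω)
      have h5 := hω.eq
      rw [← hω'] at h5
      rw [CoxeterSystem.IsReduced]
      rw [cs.wordProd_cons, ← hω'] at h4 ⊢
      simp only [List.length_cons] at h4 ⊢
      rw [mul_assoc] at hl
      omega
    have hw : cs.simple a * w₁ * cs.simple s = cs.wordProd (a :: ω) := by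
      rw [mul_assoc, hω', cs.wordProd_cons]
    rw [hw]
    obtain ⟨τ, hτ, rfl, hτr⟩ := hu.exists_sublist _ hw₁
    obtain ⟨τ₁, τ₂, rfl, h1, h2⟩ := List.sublist_append_iff.mp hτ
    rcases List.sublist_singleton.mp h2 with rfl | rfl
    · rw [List.append_nil]
      exact Or.inl (bruhatLE_of_sublist cs hred (h1.cons a))
    · right
      have e1 : cs.simple a * cs.wordProd (τ₁ ++ [s]) * cs.simple s =
          cs.wordProd (a :: τ₁) := by
        rw [cs.wordProd_cons, cs.wordProd_append, cs.wordProd_singleton]; simp [mul_assoc]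
      rw [e1, hτr.eq]
      refine ⟨bruhatLE_of_sublist cs hred (h1.cons_cons a), ?_⟩
      refine (cs.length_wordProd_le _).trans (by simp)

end Bruhat

section Spectral

/-- The spectral theorem for a positive definite symmetric bilinear form. -/
lemma exists_orthonormal_eigenvectors {V : Type*} [AddCommGroup V] [Module ℝ V]
    [FiniteDimensional ℝ V] (B : LinearMap.BilinForm ℝ V) (hsymm : ∀ x y, B x y = B y x)
    (hpos : ∀ x, x ≠ 0 → 0 < B x x) (G : V →ₗ[ℝ] V) (hG : ∀ x y, B (G x) y = B x (G y)) :
    ∃ (n : ℕ) (b : Fin n → V) (μ : Fin n → ℝ),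
      (∀ k l, B (b k) (b l) = if k = l then 1 else 0) ∧ (∀ k, G (b k) = μ k • b k) ∧
      ∀ v, v = ∑ k, B (b k) v • b k := by
  let core : InnerProductSpace.Core ℝ V :=
    { inner := fun x y => B x y
      conj_inner_symm := fun x y => by simp [hsymm x y]
      re_inner_nonneg := fun x => by
        rcases eq_or_ne x 0 with rfl | h
        · simp
        · simpa using (hpos x h).le
      add_left := fun x y z => by simp
      smul_left := fun x y r => by simp
      definite := fun x hx => by
        by_contra h
        exact (hpos x h).ne' hx }
  let : NormedAddCommGroup V := core.toNormedAddCommGroup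
  let : InnerProductSpace ℝ V := InnerProductSpace.ofCore core.toCore
  have hsym : G.IsSymmetric := hG
  refine ⟨Module.finrank ℝ V, hsym.eigenvectorBasis rfl, hsym.eigenvalues rfl, fun k l => ?_,
    fun k => ?_, fun v => ?_⟩
  · have := orthonormal_iff_ite.mp (hsym.eigenvectorBasis rfl).orthonormal k l
    exact this
  · exact hsym.apply_eigenvectorBasis rfl k
  · exact ((hsym.eigenvectorBasis rfl).sum_repr' v).symm

lemma exists_represent {V : Type*} [AddCommGroup V] [Module ℝ V]
    [FiniteDimensional ℝ V] (B : LinearMap.BilinForm ℝ V) (hsymm : ∀ x y, B x y = B y x)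
    (hpos : ∀ x, x ≠ 0 → 0 < B x x) (f : Module.Dual ℝ V) : ∃ p, ∀ v, B v p = f v := by
  obtain ⟨n, b, -, -, -, hb⟩ := exists_orthonormal_eigenvectors B hsymm hpos 0 (by simp)
  refine ⟨∑ k, f (b k) • b k, fun v => ?_⟩
  conv_rhs => rw [hb v]
  simp only [map_sum, map_smul, smul_eq_mul]
  refine Finset.sum_congr rfl fun k _ => ?_
  rw [hsymm v, mul_comm]

end Spectral

section Roots

lemma simpleRoot_nonneg [DecidableEq I] (i : I) : (0 : I → ℝ) ≤ simpleRoot i := by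
  simp [simpleRoot, Pi.single_nonneg]

open scoped Classical in
/-- The (finite) set of roots. -/
noncomputable def rootSet [Fintype I] [DecidableEq I] [Fintype W] (cs : CoxeterSystem M W) :
    Finset (I → ℝ) :=
  Finset.univ.image fun p : W × I => geomRep cs p.1 (simpleRoot p.2)

variable [Fintype I] [DecidableEq I] [Fintype W]

lemma mem_rootSet {cs : CoxeterSystem M W} {v : I → ℝ} :
    v ∈ rootSet cs ↔ ∃ w i, v = geomRep cs w (simpleRoot i) := by
  simp [rootSet, eq_comm]

lemma simpleRoot_mem_rootSet (cs : CoxeterSystem M W) (i : I) : simpleRoot i ∈ rootSet cs :=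
  mem_rootSet.mpr ⟨1, i, (geomRep_one_apply cs _).symm⟩

lemma geomRep_mem_rootSet (cs : CoxeterSystem M W) (w : W) {v : I → ℝ} (hv : v ∈ rootSet cs) :
    geomRep cs w v ∈ rootSet cs := by
  obtain ⟨x, i, rfl⟩ := mem_rootSet.mp hv
  exact mem_rootSet.mpr ⟨w * x, i, by rw [geomRep_mul_apply]⟩

lemma rootSet_nonneg_or_nonpos {cs : CoxeterSystem M W} {v : I → ℝ} (hv : v ∈ rootSet cs) :
    0 ≤ v ∨ v ≤ 0 := by
  obtain ⟨x, i, rfl⟩ := mem_rootSet.mp hv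
  exact geomRep_nonneg_or_nonpos cs x i

lemma ne_zero_of_mem_rootSet {cs : CoxeterSystem M W} {v : I → ℝ} (hv : v ∈ rootSet cs) :
    v ≠ 0 := by
  obtain ⟨x, i, rfl⟩ := mem_rootSet.mp hv
  exact geomRep_simpleRoot_ne_zero cs x i

lemma eq_simpleRoot_of_mem_rootSet {cs : CoxeterSystem M W} {v : I → ℝ} (hv : v ∈ rootSet cs)
    {a : I} (h1 : 0 ≤ v) (h2 : geomRep cs (cs.simple a) v ≤ 0) : v = simpleRoot a := by
  obtain ⟨x, i, rfl⟩ := mem_rootSet.mp hv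
  rw [← geomRep_mul_apply] at h2
  exact geomRep_eq_simpleRoot cs x i a h1 h2

open scoped Classical in
/-- The length is the number of positive roots made negative. -/
theorem length_eq_card (cs : CoxeterSystem M W) (w : W) :
    cs.length w = ((rootSet cs).filter fun v => 0 ≤ v ∧ geomRep cs w v ≤ 0).card := by
  have key : ∀ (w : W) (i : I), cs.length w < cs.length (w * cs.simple i) →
      ((rootSet cs).filter fun v => 0 ≤ v ∧ geomRep cs (w * cs.simple i) v ≤ 0).card =
      ((rootSet cs).filter fun v => 0 ≤ v ∧ geomRep cs w v ≤ 0).card + 1 := by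
    intro w i hlt
    have hpos := geomRep_simpleRoot_nonneg cs w i hlt
    have hnot : simpleRoot i ∉ ((rootSet cs).filter fun v => 0 ≤ v ∧ geomRep cs w v ≤ 0).image
        (geomRep cs (cs.simple i)) := by
      intro h
      simp only [Finset.mem_image, Finset.mem_filter] at h
      obtain ⟨v, ⟨hv, hv0, -⟩, hv'⟩ := h
      have : v = -simpleRoot i := by
        rw [← geomRep_simple_self cs, ← hv', ← geomRep_mul_apply, cs.simple_mul_simple_self,
          geomRep_one_apply]
      rw [this] at hv0 hv
      exact ne_zero_of_mem_rootSet hv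
        (le_antisymm (neg_nonpos.mpr (simpleRoot_nonneg i)) hv0)
    rw [← Finset.card_image_of_injective (f := geomRep cs (cs.simple i))
      ((rootSet cs).filter fun v => 0 ≤ v ∧ geomRep cs w v ≤ 0)
      (LinearEquiv.injective _), ← Finset.card_insert_of_notMem hnot]
    congr 1
    ext v
    simp only [Finset.mem_insert, Finset.mem_image, Finset.mem_filter]
    constructor
    · rintro ⟨hv, hv0, hv1⟩
      by_cases hvi : v = simpleRoot i
      · exact Or.inl hvi
      refine Or.inr ⟨geomRep cs (cs.simple i) v, ⟨geomRep_mem_rootSet cs _ hv, ?_, ?_⟩, ?_⟩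
      · rcases rootSet_nonneg_or_nonpos (geomRep_mem_rootSet cs (cs.simple i) hv) with h | h
        · exact h
        · exact (hvi (eq_simpleRoot_of_mem_rootSet hv hv0 h)).elim
      · rwa [← geomRep_mul_apply]
      · rw [← geomRep_mul_apply, cs.simple_mul_simple_self, geomRep_one_apply]
    · rintro (rfl | ⟨v, ⟨hv, hv0, hv1⟩, rfl⟩)
      · refine ⟨simpleRoot_mem_rootSet cs _, simpleRoot_nonneg _, ?_⟩
        rw [geomRep_mul_apply, geomRep_simple_self, map_neg]
        exact neg_nonpos.mpr hpos
      · refine ⟨geomRep_mem_rootSet cs _ hv, ?_, ?_⟩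
        · rcases rootSet_nonneg_or_nonpos (geomRep_mem_rootSet cs (cs.simple i) hv) with h | h
          · exact h
          · exfalso
            have := eq_simpleRoot_of_mem_rootSet hv hv0 h
            rw [this] at hv1
            exact geomRep_not_nonneg_and_nonpos cs w i hpos hv1
        · rwa [← geomRep_mul_apply, mul_assoc, cs.simple_mul_simple_self, mul_one]
  obtain ⟨ω, hω, rfl⟩ := cs.exists_isReduced w
  induction ω using List.reverseRecOn with
  | nil =>
    symm
    simp only [cs.wordProd_nil, cs.length_one, Finset.card_eq_zero, geomRep_one_apply]
    rw [Finset.filter_eq_empty_iff]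
    rintro v hv ⟨h1, h2⟩
    exact ne_zero_of_mem_rootSet hv (le_antisymm h2 h1)
  | append_singleton ω i ih =>
    have h0 := IsReduced.of_append_singleton hω
    have h1 := hω.eq
    rw [cs.wordProd_append, cs.wordProd_singleton, List.length_append, List.length_singleton,
      ← h0.eq] at h1
    rw [cs.wordProd_append, cs.wordProd_singleton, key _ _ (by omega), h1, ih h0]

/-- The average over the group of the standard inner product. -/
noncomputable def avgForm (cs : CoxeterSystem M W) : LinearMap.BilinForm ℝ (I → ℝ) :=
  ∑ w : W, (Matrix.toBilin' (1 : Matrix I I ℝ)).compl₁₂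
    (geomRep cs w).toLinearMap (geomRep cs w).toLinearMap

lemma avgForm_apply (cs : CoxeterSystem M W) (x y : I → ℝ) :
    avgForm cs x y = ∑ w : W, ∑ i, geomRep cs w x i * geomRep cs w y i := by
  simp only [avgForm, LinearMap.sum_apply, LinearMap.compl₁₂_apply, LinearEquiv.coe_coe]
  refine Finset.sum_congr rfl fun w _ => ?_
  simp [Matrix.toBilin'_apply', dotProduct]

lemma avgForm_comm (cs : CoxeterSystem M W) (x y : I → ℝ) : avgForm cs x y = avgForm cs y x := by
  simp only [avgForm_apply, mul_comm]

lemma avgForm_self_pos (cs : CoxeterSystem M W) (x : I → ℝ) (hx : x ≠ 0) :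
    0 < avgForm cs x x := by
  rw [avgForm_apply]
  refine Finset.sum_pos (fun w _ => ?_) Finset.univ_nonempty
  obtain ⟨i, hi⟩ := Function.ne_iff.mp
    (show geomRep cs w x ≠ 0 by rwa [Ne, LinearEquiv.map_eq_zero_iff])
  exact Finset.sum_pos' (fun i _ => mul_self_nonneg _) ⟨i, Finset.mem_univ i, mul_self_pos.mpr hi⟩

lemma avgForm_geomRep (cs : CoxeterSystem M W) (w : W) (x y : I → ℝ) :
    avgForm cs (geomRep cs w x) (geomRep cs w y) = avgForm cs x y := by
  simp only [avgForm_apply, ← geomRep_mul_apply]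
  exact Equiv.sum_comp (Equiv.mulRight w) fun z => ∑ i, geomRep cs z x i * geomRep cs z y i

lemma avgForm_geomRep_left (cs : CoxeterSystem M W) (w : W) (x y : I → ℝ) :
    avgForm cs (geomRep cs w x) y = avgForm cs x (geomRep cs w⁻¹ y) := by
  rw [← avgForm_geomRep cs w x, geomRep_apply_inv_self]

lemma avgForm_simpleRoot (cs : CoxeterSystem M W) (i : I) (y : I → ℝ) :
    avgForm cs (simpleRoot i) y =
      form M (simpleRoot i) y * avgForm cs (simpleRoot i) (simpleRoot i) := by
  have h := avgForm_geomRep cs (cs.simple i) (simpleRoot i) y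
  rw [geomRep_simple_self, geomRep_simple] at h
  simp only [map_neg, LinearMap.neg_apply, map_sub, map_smul, smul_eq_mul] at h
  linarith

/-- An inner product against a vector of the closed dominant chamber is monotone. -/
lemma avgForm_nonneg_of_nonneg (cs : CoxeterSystem M W) {z v : I → ℝ}
    (hz : ∀ j, 0 ≤ avgForm cs z (simpleRoot j)) (hv : 0 ≤ v) : 0 ≤ avgForm cs z v := by
  rw [eq_sum_simpleRoot v, map_sum]
  refine Finset.sum_nonneg fun i _ => ?_
  rw [map_smul]
  exact mul_nonneg (hv i) (hz i)

/-- A strictly dominant vector. -/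
lemma exists_dominant (cs : CoxeterSystem M W) :
    ∃ ρ : I → ℝ, ∀ j, 0 < avgForm cs (simpleRoot j) ρ := by
  obtain ⟨ρ, hρ⟩ := exists_represent (avgForm cs) (avgForm_comm cs) (avgForm_self_pos cs)
    (∑ i, LinearMap.proj i)
  refine ⟨ρ, fun j => ?_⟩
  rw [hρ]
  simp [simpleRoot, Pi.single_apply]

end Roots

section DiagramAutomorphism

/-- The permutation of the coordinates induced by a permutation of the simple reflections. -/
noncomputable def permRep (σ : I ≃ I) : (I → ℝ) ≃ₗ[ℝ] (I → ℝ) := LinearEquiv.funCongrLeft ℝ ℝ σ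

lemma permRep_apply (σ : I ≃ I) (v : I → ℝ) (i : I) : permRep σ v i = v (σ i) := rfl

lemma permRep_nonneg_iff (σ : I ≃ I) (v : I → ℝ) : 0 ≤ permRep σ v ↔ 0 ≤ v := by
  refine ⟨fun h i => ?_, fun h i => h (σ i)⟩
  simpa [permRep_apply] using h (σ.symm i)

lemma permRep_nonpos_iff (σ : I ≃ I) (v : I → ℝ) : permRep σ v ≤ 0 ↔ v ≤ 0 := by
  refine ⟨fun h i => ?_, fun h i => h (σ i)⟩
  simpa [permRep_apply] using h (σ.symm i)

lemma permRep_simpleRoot [DecidableEq I] (σ : I ≃ I) (i : I) :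
    permRep σ (simpleRoot (σ i)) = simpleRoot i := by
  ext k
  simp [permRep_apply, simpleRoot, Pi.single_apply]

variable [Fintype I] [DecidableEq I]

lemma form_permRep (σ : I ≃ I) (hσ : ∀ i j, M (σ i) (σ j) = M i j) (i : I) (v : I → ℝ) :
    form M (simpleRoot i) (permRep σ v) = form M (simpleRoot (σ i)) v := by
  conv_lhs => rw [eq_sum_simpleRoot (permRep σ v)]
  conv_rhs => rw [eq_sum_simpleRoot v, ← σ.sum_comp]
  simp only [map_sum, map_smul, form_simpleRoot, hσ, permRep_apply]

lemma permRep_geomRep (cs : CoxeterSystem M W) (σ : I ≃ I) (hσ : ∀ i j, M (σ i) (σ j) = M i j)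
    (σW : W ≃* W) (hσW : ∀ i, σW (cs.simple i) = cs.simple (σ i)) (w : W) (v : I → ℝ) :
    permRep σ (geomRep cs (σW w) v) = geomRep cs w (permRep σ v) := by
  induction w using cs.simple_induction_left with
  | one => simp only [map_one]; rfl
  | mul_simple_left w i ih =>
    rw [map_mul, hσW, geomRep_mul_apply, geomRep_mul_apply, ← ih, geomRep_simple, geomRep_simple,
      form_permRep σ hσ, map_sub, map_smul, permRep_simpleRoot]

lemma permRep_mem_rootSet [Fintype W] (cs : CoxeterSystem M W) (σ : I ≃ I)
    (hσ : ∀ i j, M (σ i) (σ j) = M i j)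
    (σW : W ≃* W) (hσW : ∀ i, σW (cs.simple i) = cs.simple (σ i)) {v : I → ℝ}
    (hv : v ∈ rootSet cs) : permRep σ v ∈ rootSet cs := by
  obtain ⟨w, i, rfl⟩ := mem_rootSet.mp hv
  refine mem_rootSet.mpr ⟨σW.symm w, σ.symm i, ?_⟩
  rw [← permRep_simpleRoot σ (σ.symm i), ← permRep_geomRep cs σ hσ σW hσW]
  simp

lemma avgForm_permRep [Fintype W] (cs : CoxeterSystem M W) (σ : I ≃ I)
    (hσ : ∀ i j, M (σ i) (σ j) = M i j)
    (σW : W ≃* W) (hσW : ∀ i, σW (cs.simple i) = cs.simple (σ i)) (x y : I → ℝ) :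
    avgForm cs (permRep σ x) (permRep σ y) = avgForm cs x y := by
  simp only [avgForm_apply, ← permRep_geomRep cs σ hσ σW hσW, permRep_apply]
  rw [← σW.toEquiv.sum_comp fun w => ∑ i, geomRep cs w x i * geomRep cs w y i]
  refine Finset.sum_congr rfl fun w _ => ?_
  exact σ.sum_comp fun i => geomRep cs (σW w) x i * geomRep cs (σW w) y i

end DiagramAutomorphism

section Analysis

open Filter Topology

lemma eventually_nonneg_or_neg {f : ℝ → ℝ} (hf : Continuous f) {t : ℝ} (ha : AnalyticAt ℝ f t) :
    (∀ᶠ s in 𝓝[>] t, 0 ≤ f s) ∨ (∀ᶠ s in 𝓝[>] t, f s < 0) := by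
  have hle : 𝓝[>] t ≤ 𝓝[≠] t := nhdsWithin_mono _ fun s hs => ne_of_gt hs
  rcases ha.eventually_eq_zero_or_eventually_ne_zero with h | h
  · exact Or.inl ((h.filter_mono nhdsWithin_le_nhds).mono fun s hs => hs.ge)
  obtain ⟨u, hu, hsub⟩ := (mem_nhdsGT_iff_exists_Ioo_subset).mp (h.filter_mono hle)
  have hmem : Set.Ioo t u ∈ 𝓝[>] t := Ioo_mem_nhdsGT hu
  by_cases hneg : ∃ a ∈ Set.Ioo t u, f a < 0
  · obtain ⟨a, ha, hfa⟩ := hneg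
    refine Or.inr (mem_of_superset hmem fun s hs => ?_)
    by_contra hcon
    obtain ⟨r, hr, hr0⟩ := (isPreconnected_Ioo (a := t) (b := u)).intermediate_value ha hs
      hf.continuousOn ⟨hfa.le, not_lt.mp hcon⟩
    exact hsub hr hr0
  · push Not at hneg
    exact Or.inl (mem_of_superset hmem hneg)

/-- Solutions of a linear system with nonnegative coefficients cannot leave the positive cone. -/
lemma eq_empty_of_nonneg_system {ι : Type*} [Fintype ι] [DecidableEq ι] (f : ι → ℝ → ℝ)
    (g : ι → ι → ℝ) (N : Finset ι) {t u : ℝ} (htu : t < u)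
    (hderiv : ∀ j s, HasDerivAt (f j) (∑ i, g j i * f i s) s)
    (hg : ∀ j ∈ N, ∀ i, 0 ≤ g j i) (h0 : ∀ j ∈ N, f j t = 0)
    (hneg : ∀ j ∈ N, ∀ s ∈ Set.Ioo t u, f j s < 0)
    (hpos : ∀ j, j ∉ N → ∀ s ∈ Set.Ioo t u, 0 ≤ f j s) : N = ∅ := by
  by_contra hN
  obtain ⟨m, hm⟩ := Finset.nonempty_iff_ne_empty.mpr hN
  set C : ℝ := ∑ j ∈ N, ∑ i, g j i with hC
  set b : ℝ → ℝ := fun s => ∑ j ∈ N, -f j s with hb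
  have hb' : ∀ s, HasDerivAt b (∑ j ∈ N, -∑ i, g j i * f i s) s := fun s =>
    HasDerivAt.fun_sum fun j _ => (hderiv j s).neg
  have hbound : ∀ s ∈ Set.Ioo t u, (∑ j ∈ N, -∑ i, g j i * f i s) ≤ C * b s := by
    intro s hs
    have hbs : ∀ i ∈ N, -f i s ≤ b s := fun i hi =>
      Finset.single_le_sum (f := fun j => -f j s)
        (fun j hj => (neg_pos.mpr (hneg j hj s hs)).le) hi
    have hbs0 : 0 ≤ b s := Finset.sum_nonneg fun j hj => (neg_pos.mpr (hneg j hj s hs)).le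
    rw [hC, Finset.sum_mul]
    refine Finset.sum_le_sum fun j hj => ?_
    rw [Finset.sum_mul, ← Finset.sum_neg_distrib]
    refine Finset.sum_le_sum fun i _ => ?_
    rw [← mul_neg]
    refine mul_le_mul_of_nonneg_left ?_ (hg j hj i)
    by_cases hi : i ∈ N
    · exact hbs i hi
    · exact (neg_nonpos.mpr (hpos i hi s hs)).trans hbs0
  set F : ℝ → ℝ := fun s => Real.exp (-C * s) * b s with hF
  have hF' : ∀ s, HasDerivAt F (Real.exp (-C * s) * (-C * 1) * b s +
      Real.exp (-C * s) * (∑ j ∈ N, -∑ i, g j i * f i s)) s := fun s =>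
    (((hasDerivAt_id s).const_mul (-C)).exp).mul (hb' s)
  have hanti : AntitoneOn F (Set.Icc t ((t + u) / 2)) := by
    apply antitoneOn_of_deriv_nonpos (convex_Icc _ _)
    · exact fun s _ => (hF' s).continuousAt.continuousWithinAt
    · exact fun s _ => (hF' s).differentiableAt.differentiableWithinAt
    · intro s hs
      rw [interior_Icc] at hs
      rw [(hF' s).deriv]
      have h1 := hbound s ⟨hs.1, by linarith [hs.2]⟩
      have h2 := Real.exp_pos (-C * s)
      nlinarith
  have h1 := hanti (Set.left_mem_Icc.mpr (by linarith)) (Set.right_mem_Icc.mpr (by linarith))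
    (by linarith : t ≤ (t + u) / 2)
  have hbt : b t = 0 := Finset.sum_eq_zero fun j hj => by rw [h0 j hj, neg_zero]
  have hbu : 0 < b ((t + u) / 2) := Finset.sum_pos
    (fun j hj => neg_pos.mpr (hneg j hj _ ⟨by linarith, by linarith⟩)) ⟨m, hm⟩
  rw [hF] at h1
  simp only [hbt, mul_zero] at h1
  have := mul_pos (Real.exp_pos (-C * ((t + u) / 2))) hbu
  linarith

lemma tendsto_sum_exp {n : ℕ} (c μ : Fin n → ℝ) (Λ : ℝ) (hΛ : ∀ k, Λ < μ k → c k = 0) :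
    Tendsto (fun s : ℝ => Real.exp (-Λ * s) * ∑ k, Real.exp (s * μ k) * c k) atTop
      (𝓝 (∑ k, if μ k = Λ then c k else 0)) := by
  simp only [Finset.mul_sum, ← mul_assoc, ← Real.exp_add]
  refine tendsto_finsetSum _ fun k _ => ?_
  rcases lt_trichotomy (μ k) Λ with h | h | h
  · rw [if_neg h.ne]
    have : Tendsto (fun s : ℝ => Real.exp (-Λ * s + s * μ k) * c k) atTop (𝓝 (0 * c k)) := by
      refine Tendsto.mul_const _ (Real.tendsto_exp_atBot.comp ?_)
      have e : (fun s : ℝ => -Λ * s + s * μ k) = fun s => s * (μ k - Λ) := by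
        ext s; ring
      rw [e]
      exact tendsto_id.atTop_mul_const_of_neg (by linarith)
    simpa using this
  · rw [if_pos h]
    simp [h, mul_comm]
  · simp [hΛ k h]

lemma eventually_sum_exp_pos {n : ℕ} (c μ : Fin n → ℝ) (Λ : ℝ) (hΛ : ∀ k, Λ < μ k → c k = 0)
    (hA : 0 < ∑ k, if μ k = Λ then c k else 0) :
    ∀ᶠ s : ℝ in atTop, 0 < ∑ k, Real.exp (s * μ k) * c k := by
  filter_upwards [(tendsto_sum_exp c μ Λ hΛ).eventually (lt_mem_nhds hA)] with s hs
  exact pos_of_mul_pos_right hs (Real.exp_pos _).le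

end Analysis

section Sturm

open scoped Classical in
/-- A discrete Sturm separation principle: two nowhere vanishing solutions of the same second
order recurrence along a permutation of a finite set have the same number of sign changes. -/
lemma card_sign_changes_eq {V : Type*} (Φ : Finset V) (T : V → V) (hT : Set.InjOn T Φ)
    (hTΦ : ∀ γ ∈ Φ, T γ ∈ Φ) (a b c : V → ℝ) (ha0 : ∀ γ ∈ Φ, a γ ≠ 0) (hb0 : ∀ γ ∈ Φ, b γ ≠ 0)
    (ha : ∀ γ ∈ Φ, a (T (T γ)) + a γ = c γ * a (T γ))
    (hb : ∀ γ ∈ Φ, b (T (T γ)) + b γ = c γ * b (T γ)) :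
    (Φ.filter fun γ => 0 < a γ ∧ a (T γ) < 0).card =
      (Φ.filter fun γ => 0 < b γ ∧ b (T γ) < 0).card := by
  have himg : Φ.image T = Φ := Finset.eq_of_subset_of_card_le
    (Finset.image_subset_iff.mpr hTΦ) (Finset.card_image_of_injOn hT).ge
  let D : V → ℝ := fun γ => a γ * b (T γ) - a (T γ) * b γ
  have hD : ∀ γ ∈ Φ, D (T γ) = D γ := by
    intro γ hγ
    have h1 : a (T (T γ)) = c γ * a (T γ) - a γ := by linarith [ha γ hγ]
    have h2 : b (T (T γ)) = c γ * b (T γ) - b γ := by linarith [hb γ hγ]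
    simp only [D, h1, h2]
    ring
  let h : V → ℤ := fun γ => if 0 ≤ D γ then (if a γ < 0 ∧ 0 < b γ then 1 else 0)
    else (if b γ < 0 ∧ 0 < a γ then -1 else 0)
  have key : ∀ γ ∈ Φ, ((if 0 < a γ ∧ a (T γ) < 0 then 1 else 0 : ℤ) -
      (if 0 < b γ ∧ b (T γ) < 0 then 1 else 0 : ℤ)) = h (T γ) - h γ := by
    intro γ hγ
    simp only [h, hD γ hγ]
    have hDγ : D γ = a γ * b (T γ) - a (T γ) * b γ := rfl
    rcases (ha0 γ hγ).lt_or_gt with h1 | h1 <;>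
    rcases (hb0 γ hγ).lt_or_gt with h2 | h2 <;>
    rcases (ha0 _ (hTΦ γ hγ)).lt_or_gt with h3 | h3 <;>
    rcases (hb0 _ (hTΦ γ hγ)).lt_or_gt with h4 | h4 <;>
    by_cases h5 : 0 ≤ D γ <;>
    simp [h1, h2, h3, h4, h5, not_lt.mpr h1.le, not_lt.mpr h2.le, not_lt.mpr h3.le,
      not_lt.mpr h4.le] <;>
    nlinarith
  have hsum : ∑ γ ∈ Φ, h (T γ) = ∑ γ ∈ Φ, h γ := by
    conv_rhs => rw [← himg]
    rw [Finset.sum_image hT]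
  have := Finset.sum_congr (rfl : Φ = Φ) key
  rw [Finset.sum_sub_distrib, Finset.sum_sub_distrib, hsum, sub_self, sub_eq_zero] at this
  simpa [Finset.sum_boole] using this

end Sturm

section Chambers

open Filter Topology

variable [Fintype I] [DecidableEq I] [Fintype W]

/-- `q` lies in the closed chamber of `x`. -/
def inChamber (cs : CoxeterSystem M W) (x : W) (q : I → ℝ) : Prop :=
  ∀ j, 0 ≤ avgForm cs (geomRep cs x (simpleRoot j)) q

omit [Fintype W] in
lemma geomRep_mul_simple (cs : CoxeterSystem M W) (x : W) (j : I) (v : I → ℝ) :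
    geomRep cs (x * cs.simple j) v =
      geomRep cs x v - (2 * form M (simpleRoot j) v) • geomRep cs x (simpleRoot j) := by
  rw [geomRep_mul_apply, geomRep_simple, map_sub, map_smul]

lemma avgForm_lt_mul_simple {cs : CoxeterSystem M W} {ρ : I → ℝ}
    (hρ : ∀ j, 0 < avgForm cs (simpleRoot j) ρ) (x : W) (j : I) (q : I → ℝ)
    (hq : avgForm cs (geomRep cs x (simpleRoot j)) q < 0) :
    avgForm cs (geomRep cs x ρ) q < avgForm cs (geomRep cs (x * cs.simple j) ρ) q := by
  have h1 : 0 < form M (simpleRoot j) ρ := by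
    have := hρ j
    rw [avgForm_simpleRoot] at this
    exact pos_of_mul_pos_left this
      (avgForm_self_pos cs _ (by simp [simpleRoot])).le
  rw [geomRep_mul_simple, map_sub, map_smul, LinearMap.sub_apply, LinearMap.smul_apply,
    smul_eq_mul]
  nlinarith

lemma inChamber_mul_simple {cs : CoxeterSystem M W} {x : W} {j : I} {q : I → ℝ}
    (h : inChamber cs x q) (hj : avgForm cs (geomRep cs x (simpleRoot j)) q = 0) :
    inChamber cs (x * cs.simple j) q := by
  intro i
  rw [geomRep_mul_simple, map_sub, map_smul, LinearMap.sub_apply, LinearMap.smul_apply, hj,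
    smul_zero, sub_zero]
  exact h i

/-- A trajectory that starts in one of the chambers of `X` and whose velocity points inwards along
all walls bounding `X` stays in the chambers of `X`. -/
theorem exists_inChamber_of_flow (cs : CoxeterSystem M W) (X : Set W)
    (G : (I → ℝ) →ₗ[ℝ] (I → ℝ))
    (hX : ∀ x ∈ X, ∀ j, x * cs.simple j ∉ X →
      0 ≤ geomRep cs x⁻¹ (G (geomRep cs x (simpleRoot j))))
    (q : ℝ → I → ℝ)
    (hderiv : ∀ v s, HasDerivAt (fun s => avgForm cs v (q s)) (avgForm cs (G v) (q s)) s)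
    (han : ∀ v s, AnalyticAt ℝ (fun s => avgForm cs v (q s)) s)
    (h0 : ∃ x ∈ X, inChamber cs x (q 0)) (s : ℝ) (hs : 0 ≤ s) :
    ∃ x ∈ X, inChamber cs x (q s) := by
  classical
  have hcont : ∀ v, Continuous fun s => avgForm cs v (q s) := fun v =>
    continuous_iff_continuousAt.mpr fun s => (hderiv v s).continuousAt
  let S : Set ℝ := {s | ∃ x ∈ X, inChamber cs x (q s)}
  have hSclosed : IsClosed S := by
    have e : S = ⋃ x ∈ X, ⋂ j, {s | 0 ≤ avgForm cs (geomRep cs x (simpleRoot j)) (q s)} := by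
      ext s
      simp [S, inChamber]
    rw [e]
    refine Set.Finite.isClosed_biUnion (Set.toFinite X) fun x _ => isClosed_iInter fun j => ?_
    exact isClosed_le continuous_const (hcont _)
  obtain ⟨ρ, hρ⟩ := exists_dominant cs
  suffices hsub : Set.Icc 0 s ⊆ S from hsub (Set.right_mem_Icc.mpr hs)
  refine IsClosed.Icc_subset_of_forall_exists_gt (hSclosed.inter isClosed_Icc) h0 ?_
  rintro t ⟨ht, -⟩ y (hy : t < y)
  have hev : ∀ᶠ r in 𝓝[>] t, ∀ v ∈ rootSet cs,
      (∀ᶠ s in 𝓝[>] t, 0 ≤ avgForm cs v (q s)) → 0 ≤ avgForm cs v (q r) := by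
    rw [Filter.eventually_all_finset]
    intro v _
    by_cases h : ∀ᶠ s in 𝓝[>] t, 0 ≤ avgForm cs v (q s)
    · exact h.mono fun r hr _ => hr
    · exact Eventually.of_forall fun r hr => (h hr).elim
  have hev' : ∀ᶠ r in 𝓝[>] t, ∀ v ∈ rootSet cs,
      (¬ ∀ᶠ s in 𝓝[>] t, 0 ≤ avgForm cs v (q s)) → avgForm cs v (q r) < 0 := by
    rw [Filter.eventually_all_finset]
    intro v _
    rcases eventually_nonneg_or_neg (hcont v) (han v t) with h | h
    · exact Eventually.of_forall fun r hr => (hr h).elim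
    · exact h.mono fun r hr _ => hr
  obtain ⟨u', hu', hsub⟩ := (mem_nhdsGT_iff_exists_Ioo_subset).mp (hev.and hev')
  have hu'' : t < u' := hu'
  set u := min u' y with hu
  have htu : t < u := lt_min hu'' hy
  set s₀ := (t + u) / 2 with hs₀
  have hs₀mem : s₀ ∈ Set.Ioo t u := ⟨by linarith, by linarith⟩
  have hioo : ∀ r ∈ Set.Ioo t u, r ∈ Set.Ioo t u' := fun r hr =>
    ⟨hr.1, hr.2.trans_le (min_le_left _ _)⟩
  obtain ⟨x, ⟨hxX, hxt⟩, hmax⟩ := Set.exists_max_image {x | x ∈ X ∧ inChamber cs x (q t)}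
    (fun x => avgForm cs (geomRep cs x ρ) (q s₀)) (Set.toFinite _) ht
  let f : I → ℝ → ℝ := fun j r => avgForm cs (geomRep cs x (simpleRoot j)) (q r)
  have hroot : ∀ j, geomRep cs x (simpleRoot j) ∈ rootSet cs := fun j =>
    mem_rootSet.mpr ⟨x, j, rfl⟩
  let N : Finset I := Finset.univ.filter fun j => ¬ ∀ᶠ r in 𝓝[>] t, 0 ≤ f j r
  have hN : N = ∅ := by
    have hneg : ∀ j ∈ N, ∀ r ∈ Set.Ioo t u, f j r < 0 := fun j hj r hr =>
      (hsub (hioo r hr)).2 _ (hroot j) (Finset.mem_filter.mp hj).2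
    have hzero : ∀ j ∈ N, f j t = 0 := by
      intro j hj
      refine le_antisymm ?_ (hxt j)
      refine le_of_tendsto ((hcont _).continuousAt.tendsto.mono_left
        (nhdsWithin_le_nhds (s := Set.Ioi t))) ?_
      exact mem_of_superset (Ioo_mem_nhdsGT htu) fun r hr => (hneg j hj r hr).le
    refine eq_empty_of_nonneg_system f
      (fun j i => geomRep cs x⁻¹ (G (geomRep cs x (simpleRoot j))) i) N htu ?_ ?_ hzero hneg ?_
    · intro j r
      convert hderiv (geomRep cs x (simpleRoot j)) r using 1
      have e : G (geomRep cs x (simpleRoot j)) =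
          geomRep cs x (∑ i, geomRep cs x⁻¹ (G (geomRep cs x (simpleRoot j))) i •
            simpleRoot i) := by
        rw [← eq_sum_simpleRoot, geomRep_apply_inv_self]
      conv_rhs => rw [e]
      simp [f, map_sum, LinearMap.sum_apply]
    · intro j hj i
      refine hX x hxX j (fun hmem => ?_) i
      have h1 := hmax (x * cs.simple j) ⟨hmem, inChamber_mul_simple hxt (hzero j hj)⟩
      have h2 := avgForm_lt_mul_simple hρ x j (q s₀) (hneg j hj s₀ hs₀mem)
      exact absurd h1 (not_le.mpr h2)
    · intro j hj r hr
      refine (hsub (hioo r hr)).1 _ (hroot j) ?_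
      by_contra hcon
      exact hj (Finset.mem_filter.mpr ⟨Finset.mem_univ j, hcon⟩)
  refine ⟨s₀, ⟨x, hxX, fun j => ?_⟩, hs₀mem.1, hs₀mem.2.le.trans (min_le_right _ _)⟩
  refine (hsub (hioo _ hs₀mem)).1 _ (hroot j) ?_
  by_contra hcon
  have : j ∈ N := Finset.mem_filter.mpr ⟨Finset.mem_univ j, hcon⟩
  rw [hN] at this
  exact absurd this (Finset.notMem_empty j)

/-- Every chamber contains a vector avoiding finitely many given hyperplanes. -/
lemma exists_generic_inChamber (cs : CoxeterSystem M W) (x : W) (U : Finset (I → ℝ))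
    (hU : ∀ u ∈ U, u ≠ 0) : ∃ p, (∀ u ∈ U, avgForm cs u p ≠ 0) ∧ inChamber cs x p := by
  obtain ⟨f, hf⟩ := Module.exists_dual_forall_apply_ne_zero (K := ℝ)
    (fun a : W × U => geomRep cs a.1 a.2) (fun a => by
      simpa using hU _ a.2.2)
  obtain ⟨v, hv⟩ := exists_represent (avgForm cs) (avgForm_comm cs) (avgForm_self_pos cs) f
  obtain ⟨ρ, hρ⟩ := exists_dominant cs
  obtain ⟨z, hz⟩ := Finite.exists_max fun z : W => avgForm cs (geomRep cs z ρ) v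
  refine ⟨geomRep cs (x * z⁻¹) v, fun u hu => ?_, fun j => ?_⟩
  · rw [avgForm_comm, avgForm_geomRep_left, avgForm_comm, hv]
    exact hf (_, ⟨u, hu⟩)
  · rw [geomRep_mul_apply, avgForm_geomRep, avgForm_comm, avgForm_geomRep_left, avgForm_comm,
      inv_inv]
    by_contra hcon
    exact absurd (hz (z * cs.simple j))
      (not_le.mpr (avgForm_lt_mul_simple hρ z j v (not_le.mp hcon)))

end Chambers

section Isometry

open Filter Topology

/-- For an isometry `T` of a Euclidean space, the gradient flow of `T + T⁻¹` is asymptotically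
governed by a nonvanishing map `u` intertwining `T + T⁻¹` with scalars. -/
theorem exists_gradient_flow {V : Type*} [AddCommGroup V] [Module ℝ V]
    [FiniteDimensional ℝ V] (B : LinearMap.BilinForm ℝ V) (hsymm : ∀ x y, B x y = B y x)
    (hpos : ∀ x, x ≠ 0 → 0 < B x x) (T : V ≃ₗ[ℝ] V) (hT : ∀ x y, B (T x) (T y) = B x y) :
    ∃ (u : V → V) (Λ : V → ℝ), (∀ γ, γ ≠ 0 → u γ ≠ 0) ∧
      (∀ γ, u (T (T γ)) + u γ = Λ γ • u (T γ)) ∧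
      ∀ p, ∃ q : ℝ → V, q 0 = p ∧
        (∀ v s, HasDerivAt (fun s => B v (q s)) (B (T v + T.symm v) (q s)) s) ∧
        (∀ v s, AnalyticAt ℝ (fun s => B v (q s)) s) ∧
        ∀ γ, (0 < B (u γ) p → ∀ᶠ s in atTop, 0 < B γ (q s)) ∧
          (B (u γ) p < 0 → ∀ᶠ s in atTop, B γ (q s) < 0) := by
  classical
  have hT1 : ∀ x y, B (T x) y = B x (T.symm y) := fun x y => by
    rw [← hT x (T.symm y), T.apply_symm_apply]
  have hT2 : ∀ x y, B (T.symm x) y = B x (T y) := fun x y => by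
    rw [← hT (T.symm x) y, T.apply_symm_apply]
  let G : V →ₗ[ℝ] V := T.toLinearMap + T.symm.toLinearMap
  have hGapp : ∀ v, G v = T v + T.symm v := fun v => rfl
  have hG : ∀ x y, B (G x) y = B x (G y) := fun x y => by
    simp only [hGapp, map_add, LinearMap.add_apply, hT1, hT2, add_comm]
  obtain ⟨n, b, μ, hon, heig, hexp⟩ := exists_orthonormal_eigenvectors B hsymm hpos G hG
  have hmul : ∀ k v, B (b k) (G v) = μ k * B (b k) v := fun k v => by
    rw [← hG, heig, map_smul, LinearMap.smul_apply, smul_eq_mul]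
  have hparseval : ∀ v w, B v w = ∑ k, B (b k) v * B (b k) w := fun v w => by
    conv_lhs => rw [hexp w]
    simp only [map_sum, map_smul, smul_eq_mul]
    exact Finset.sum_congr rfl fun k _ => by rw [hsymm v, mul_comm]
  let E : V → Set ℝ := fun γ => {l | ∃ k, μ k = l ∧ B (b k) γ ≠ 0}
  have hEsub : ∀ (S S' : V ≃ₗ[ℝ] V), (∀ x y, B x (S y) = B (S' x) y) →
      (∀ x, G (S' x) = S' (G x)) → ∀ γ, E (S γ) ⊆ E γ := by
    rintro S S' hS hGS γ _ ⟨k, rfl, hk⟩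
    rw [hS, hparseval] at hk
    obtain ⟨l, -, hl⟩ := Finset.exists_ne_zero_of_sum_ne_zero hk
    refine ⟨l, ?_, right_ne_zero_of_mul hl⟩
    have h1 := hmul l (S' (b k))
    rw [hGS, heig, map_smul, map_smul, smul_eq_mul] at h1
    exact (mul_right_cancel₀ (left_ne_zero_of_mul hl) h1).symm
  have hE : ∀ γ, E (T γ) = E γ := fun γ => by
    refine (hEsub T T.symm (fun x y => (hT2 x y).symm) (fun x => by simp [hGapp]) γ).antisymm ?_
    have := hEsub T.symm T (fun x y => (hT1 x y).symm) (fun x => by simp [hGapp]) (T γ)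
    rwa [T.symm_apply_apply] at this
  have hEfin : ∀ γ, (E γ).Finite := fun γ =>
    (Set.finite_range μ).subset fun l ⟨k, hk, _⟩ => ⟨k, hk⟩
  have hEne : ∀ γ, γ ≠ 0 → (E γ).Nonempty := fun γ hγ => by
    have h := hpos γ hγ
    rw [hparseval] at h
    obtain ⟨l, -, hl⟩ := Finset.exists_ne_zero_of_sum_ne_zero h.ne'
    exact ⟨μ l, l, rfl, right_ne_zero_of_mul hl⟩
  let Λ : V → ℝ := fun γ => sSup (E γ)
  have hΛ : ∀ γ k, Λ γ < μ k → B (b k) γ = 0 := fun γ k hk => by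
    by_contra hne
    exact absurd (le_csSup (hEfin γ).bddAbove ⟨k, rfl, hne⟩) (not_le.mpr hk)
  let u : V → V := fun γ => ∑ k, (if μ k = Λ γ then B (b k) γ else 0) • b k
  have hu : ∀ γ k, B (b k) (u γ) = if μ k = Λ γ then B (b k) γ else 0 := fun γ k => by
    simp only [u, map_sum, map_smul, smul_eq_mul, hon]
    simp
  refine ⟨u, Λ, fun γ hγ h0 => ?_, fun γ => ?_, fun p => ?_⟩
  · obtain ⟨k, hk, hk'⟩ := (hEne γ hγ).csSup_mem (hEfin γ)
    have h := hu γ k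
    rw [h0, map_zero, if_pos hk] at h
    exact hk' h.symm
  · have e1 : Λ (T γ) = Λ γ := congrArg sSup (hE γ)
    have e2 : Λ (T (T γ)) = Λ γ := (congrArg sSup (hE (T γ))).trans e1
    simp only [u, e1, e2, ← Finset.sum_add_distrib, Finset.smul_sum, ← add_smul, smul_smul]
    refine Finset.sum_congr rfl fun k _ => ?_
    congr 1
    split_ifs with h
    · rw [← map_add, ← h, ← hmul, hGapp, T.symm_apply_apply]
    · simp
  · let q : ℝ → V := fun s => ∑ k, (Real.exp (s * μ k) * B (b k) p) • b k
    have hq : ∀ v s, B v (q s) = ∑ k, Real.exp (s * μ k) * (B (b k) v * B (b k) p) := by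
      intro v s
      simp only [q, map_sum, map_smul, smul_eq_mul]
      exact Finset.sum_congr rfl fun k _ => by rw [hsymm v]; ring
    have hup : ∀ γ, B (u γ) p = ∑ k, if μ k = Λ γ then B (b k) γ * B (b k) p else 0 := by
      intro γ
      rw [hparseval]
      refine Finset.sum_congr rfl fun k _ => ?_
      rw [hu]
      split_ifs <;> simp
    refine ⟨q, ?_, fun v s => ?_, fun v s => ?_, fun γ => ⟨fun h => ?_, fun h => ?_⟩⟩
    · conv_rhs => rw [hexp p]
      simp [q]
    · simp only [hq]
      rw [← hGapp]
      have hd : HasDerivAt (fun s => ∑ k, Real.exp (s * μ k) * (B (b k) v * B (b k) p))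
          (∑ k, Real.exp (s * μ k) * (1 * μ k) * (B (b k) v * B (b k) p)) s :=
        HasDerivAt.fun_sum fun k _ => (((hasDerivAt_id s).mul_const (μ k)).exp).mul_const _
      convert hd using 1
      refine Finset.sum_congr rfl fun k _ => ?_
      rw [hmul]
      ring
    · simp only [hq]
      refine Finset.analyticAt_fun_sum _ fun k _ => ?_
      fun_prop
    · rw [hup] at h
      simp only [hq]
      exact eventually_sum_exp_pos _ μ (Λ γ) (fun k hk => by rw [hΛ γ k hk, zero_mul]) h
    · rw [hup] at h
      simp only [hq]
      have h' := eventually_sum_exp_pos (fun k => -(B (b k) γ * B (b k) p)) μ (Λ γ)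
        (fun k hk => by simp [hΛ γ k hk]) (by
          rw [← neg_pos, ← Finset.sum_neg_distrib] at h
          refine h.trans_eq (Finset.sum_congr rfl fun k _ => ?_)
          split_ifs <;> simp)
      filter_upwards [h'] with s hs
      simpa using hs

end Isometry

section Steps

/-- A length non-increasing move `y ↦ s_{f k} y s_{g k}`. -/
def shiftStep (cs : CoxeterSystem M W) {K : Type*} (f g : K → I) (y y' : W) : Prop :=
  ∃ k, y' = cs.simple (f k) * y * cs.simple (g k) ∧ cs.length y' ≤ cs.length y

/-- No sequence of length non-increasing moves starting at `y` decreases the length. -/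
def Terminal (cs : CoxeterSystem M W) {K : Type*} (f g : K → I) (y : W) : Prop :=
  ∀ y', Relation.ReflTransGen (shiftStep cs f g) y y' → cs.length y' = cs.length y

lemma length_lt_mul_of_lt_mul_mul (cs : CoxeterSystem M W) {a b : I} {y : W}
    (h : cs.length y < cs.length (cs.simple a * y * cs.simple b)) :
    cs.length y < cs.length (y * cs.simple b) ∧ cs.length y < cs.length (cs.simple a * y) := by
  constructor
  · rcases cs.length_mul_simple y b with h1 | h1
    · omega
    · rw [mul_assoc] at h
      have := cs.length_simple_mul (y * cs.simple b) a
      omega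
  · rcases cs.length_simple_mul y a with h1 | h1
    · omega
    · have := cs.length_mul_simple (cs.simple a * y) b
      omega

end Steps

section TwistedConjugacy

open Filter Topology

/-- The linear automorphism attached to the element `σ⁻¹y` of the extended Coxeter group. -/
noncomputable def twistRep [Fintype I] [DecidableEq I] (cs : CoxeterSystem M W)
    (σ : I ≃ I) (y : W) :
    (I → ℝ) ≃ₗ[ℝ] (I → ℝ) :=
  (geomRep cs y).trans (permRep σ)

lemma twistRep_apply [Fintype I] [DecidableEq I] (cs : CoxeterSystem M W)
    (σ : I ≃ I) (y : W) (v : I → ℝ) :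
    twistRep cs σ y v = permRep σ (geomRep cs y v) := rfl

lemma twistRep_conj [Fintype I] [DecidableEq I] (cs : CoxeterSystem M W)
    (σ : I ≃ I) (hσ : ∀ i j, M (σ i) (σ j) = M i j)
    (σW : W ≃* W) (hσW : ∀ i, σW (cs.simple i) = cs.simple (σ i)) (x y : W) (v : I → ℝ) :
    twistRep cs σ (σW x⁻¹ * y * x) v = geomRep cs x⁻¹ (twistRep cs σ y (geomRep cs x v)) := by
  rw [twistRep_apply, twistRep_apply, ← permRep_geomRep cs σ hσ σW hσW, geomRep_mul_apply,
    geomRep_mul_apply]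

/-- If a wall of the chamber of `x` cannot be crossed without increasing the length of the twisted
conjugate, then the gradient of the displacement function points inwards there. -/
lemma nonneg_of_length_lt [Fintype I] [DecidableEq I] (cs : CoxeterSystem M W) (σ : I ≃ I)
    (hσ : ∀ i j, M (σ i) (σ j) = M i j)
    (σW : W ≃* W) (hσW : ∀ i, σW (cs.simple i) = cs.simple (σ i)) (x y : W) (j : I)
    (h : cs.length (σW x⁻¹ * y * x) <
      cs.length (cs.simple (σ j) * (σW x⁻¹ * y * x) * cs.simple j)) :
    0 ≤ geomRep cs x⁻¹ (twistRep cs σ y (geomRep cs x (simpleRoot j)) +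
      (twistRep cs σ y).symm (geomRep cs x (simpleRoot j))) := by
  obtain ⟨h1, h2⟩ := length_lt_mul_of_lt_mul_mul cs h
  rw [map_add, ← twistRep_conj cs σ hσ σW hσW, twistRep_apply]
  refine add_nonneg ((permRep_nonneg_iff σ _).mpr (geomRep_simpleRoot_nonneg cs _ _ h1)) ?_
  set z := σW x⁻¹ * y * x with hz
  have e : geomRep cs x⁻¹ ((twistRep cs σ y).symm (geomRep cs x (simpleRoot j))) =
      geomRep cs z⁻¹ (simpleRoot (σ j)) := by
    set v := geomRep cs x⁻¹ ((twistRep cs σ y).symm (geomRep cs x (simpleRoot j))) with hv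
    have h3 : twistRep cs σ z v = simpleRoot j := by
      rw [hz, twistRep_conj cs σ hσ σW hσW, hv, geomRep_apply_inv_self,
        LinearEquiv.apply_symm_apply, geomRep_inv_apply_self]
    rw [twistRep_apply, ← permRep_simpleRoot σ j, (permRep σ).injective.eq_iff] at h3
    rw [← h3, geomRep_inv_apply_self]
  rw [e]
  refine geomRep_simpleRoot_nonneg cs _ _ ?_
  have e2 : z⁻¹ * cs.simple (σ j) = (cs.simple (σ j) * z)⁻¹ := by
    rw [mul_inv_rev (cs.simple _), cs.inv_simple]
  rw [e2, cs.length_inv, cs.length_inv]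
  exact h2

variable [Fintype I] [DecidableEq I] [Fintype W]

lemma inChamber.nonneg {cs : CoxeterSystem M W} {x : W} {q : I → ℝ} (h : inChamber cs x q)
    {v : I → ℝ} (hv : 0 ≤ geomRep cs x⁻¹ v) : 0 ≤ avgForm cs v q := by
  have h1 : avgForm cs v q = avgForm cs (geomRep cs x⁻¹ q) (geomRep cs x⁻¹ v) := by
    rw [avgForm_geomRep, avgForm_comm]
  rw [h1]
  refine avgForm_nonneg_of_nonneg cs (fun j => ?_) hv
  rw [avgForm_geomRep_left, inv_inv, avgForm_comm]
  exact h j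

lemma inChamber.pos_iff {cs : CoxeterSystem M W} {x : W} {q : I → ℝ} (h : inChamber cs x q)
    {v : I → ℝ} (hv : v ∈ rootSet cs) (h0 : avgForm cs v q ≠ 0) :
    (0 ≤ geomRep cs x⁻¹ v ↔ 0 < avgForm cs v q) ∧
      (geomRep cs x⁻¹ v ≤ 0 ↔ avgForm cs v q < 0) := by
  have h1 : 0 ≤ geomRep cs x⁻¹ v → 0 < avgForm cs v q := fun hx =>
    (h.nonneg hx).lt_of_ne' h0
  have h2 : geomRep cs x⁻¹ v ≤ 0 → avgForm cs v q < 0 := fun hx => by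
    have := h.nonneg (v := -v) (by rw [map_neg]; exact neg_nonneg.mpr hx)
    rw [map_neg, LinearMap.neg_apply] at this
    exact lt_of_le_of_ne (neg_nonneg.mp this) h0
  have h3 := rootSet_nonneg_or_nonpos (geomRep_mem_rootSet cs x⁻¹ hv)
  refine ⟨⟨h1, fun hx => h3.resolve_right fun h4 => ?_⟩,
    ⟨h2, fun hx => h3.resolve_left fun h4 => ?_⟩⟩
  · exact lt_asymm hx (h2 h4)
  · exact lt_asymm hx (h1 h4)

open scoped Classical in
lemma length_eq_card_of_inChamber (cs : CoxeterSystem M W) (σ : I ≃ I)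
    (hσ : ∀ i j, M (σ i) (σ j) = M i j)
    (σW : W ≃* W) (hσW : ∀ i, σW (cs.simple i) = cs.simple (σ i)) (x y : W) (q : I → ℝ)
    (hx : inChamber cs x q) (hq : ∀ v ∈ rootSet cs, avgForm cs v q ≠ 0) :
    cs.length (σW x⁻¹ * y * x) = ((rootSet cs).filter fun v =>
      0 < avgForm cs v q ∧ avgForm cs (twistRep cs σ y v) q < 0).card := by
  have hT : ∀ v ∈ rootSet cs, twistRep cs σ y v ∈ rootSet cs := fun v hv =>
    permRep_mem_rootSet cs σ hσ σW hσW (geomRep_mem_rootSet cs y hv)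
  rw [length_eq_card]
  refine Finset.card_nbij' (geomRep cs x) (geomRep cs x⁻¹) (fun v hv => ?_) (fun v hv => ?_)
    (fun v _ => geomRep_inv_apply_self cs x v) (fun v _ => geomRep_apply_inv_self cs x v)
  · obtain ⟨hv, h1, h2⟩ := Finset.mem_filter.mp hv
    have hv' := geomRep_mem_rootSet cs x hv
    rw [← permRep_nonpos_iff σ, ← twistRep_apply, twistRep_conj cs σ hσ σW hσW,
      (hx.pos_iff (hT _ hv') (hq _ (hT _ hv'))).2] at h2
    rw [← geomRep_inv_apply_self cs x v, (hx.pos_iff hv' (hq _ hv')).1] at h1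
    exact Finset.mem_filter.mpr ⟨hv', h1, h2⟩
  · obtain ⟨hv, h1, h2⟩ := Finset.mem_filter.mp hv
    have hv' := geomRep_mem_rootSet cs x⁻¹ hv
    rw [← (hx.pos_iff (hT _ hv) (hq _ (hT _ hv))).2, ← geomRep_apply_inv_self cs x v,
      ← twistRep_conj cs σ hσ σW hσW, twistRep_apply, permRep_nonpos_iff] at h2
    rw [← (hx.pos_iff hv (hq _ hv)).1] at h1
    exact Finset.mem_filter.mpr ⟨hv', h1, h2⟩

/-- Terminal elements of a twisted conjugacy class all have the same length. -/
theorem length_eq_of_terminal_of_conj (cs : CoxeterSystem M W) (σ : I ≃ I)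
    (hσ : ∀ i j, M (σ i) (σ j) = M i j)
    (σW : W ≃* W) (hσW : ∀ i, σW (cs.simple i) = cs.simple (σ i)) (y x₁ : W)
    (h0 : Terminal cs σ id y) (h1 : Terminal cs σ id (σW x₁⁻¹ * y * x₁)) :
    cs.length (σW x₁⁻¹ * y * x₁) = cs.length y := by
  classical
  set T := twistRep cs σ y with hTdef
  have hTB : ∀ v w, avgForm cs (T v) (T w) = avgForm cs v w := fun v w => by
    rw [hTdef, twistRep_apply, twistRep_apply, avgForm_permRep cs σ hσ σW hσW, avgForm_geomRep]
  have hTΦ : ∀ v ∈ rootSet cs, T v ∈ rootSet cs := fun v hv =>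
    permRep_mem_rootSet cs σ hσ σW hσW (geomRep_mem_rootSet cs y hv)
  obtain ⟨u, Λ, hu0, hu, hflow⟩ :=
    exists_gradient_flow (avgForm cs) (avgForm_comm cs) (avgForm_self_pos cs) T hTB
  have key : ∀ x, Terminal cs σ id (σW x⁻¹ * y * x) →
      ∃ p, (∀ γ ∈ rootSet cs, avgForm cs (u γ) p ≠ 0) ∧ cs.length (σW x⁻¹ * y * x) =
        ((rootSet cs).filter fun γ =>
          0 < avgForm cs (u γ) p ∧ avgForm cs (u (T γ)) p < 0).card := by
    intro x hx
    obtain ⟨p, hp, hxp⟩ := exists_generic_inChamber cs x ((rootSet cs).image u) (by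
      simp only [Finset.mem_image]
      rintro _ ⟨γ, hγ, rfl⟩
      exact hu0 γ (ne_zero_of_mem_rootSet hγ))
    have hp : ∀ γ ∈ rootSet cs, avgForm cs (u γ) p ≠ 0 := fun γ hγ =>
      hp _ (Finset.mem_image_of_mem u hγ)
    obtain ⟨q, hq0, hderiv, han, hsign⟩ := hflow p
    let X : Set W := {z | Relation.ReflTransGen (shiftStep cs σ id)
      (σW x⁻¹ * y * x) (σW z⁻¹ * y * z)}
    have hX : ∀ z ∈ X, ∀ j, z * cs.simple j ∉ X →
        0 ≤ geomRep cs z⁻¹ ((T.toLinearMap + T.symm.toLinearMap)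
          (geomRep cs z (simpleRoot j))) := by
      intro z hz j hj
      refine nonneg_of_length_lt cs σ hσ σW hσW z y j ?_
      by_contra hcon
      refine hj (Relation.ReflTransGen.tail hz ⟨j, ?_, ?_⟩)
      · simp only [mul_inv_rev, map_mul, cs.inv_simple, hσW, id, mul_assoc]
      · simp only [mul_inv_rev, map_mul, cs.inv_simple, hσW, mul_assoc] at hcon ⊢
        exact not_lt.mp hcon
    have hev : ∀ᶠ s in atTop, ∀ γ ∈ rootSet cs,
        (0 < avgForm cs γ (q s) ↔ 0 < avgForm cs (u γ) p) ∧
        (avgForm cs γ (q s) < 0 ↔ avgForm cs (u γ) p < 0) := by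
      rw [Filter.eventually_all_finset]
      intro γ hγ
      rcases lt_or_gt_of_ne (hp γ hγ) with h | h
      · filter_upwards [(hsign γ).2 h] with s hs
        exact ⟨iff_of_false (lt_asymm hs) (lt_asymm h), iff_of_true hs h⟩
      · filter_upwards [(hsign γ).1 h] with s hs
        exact ⟨iff_of_true hs h, iff_of_false (lt_asymm hs) (lt_asymm h)⟩
    obtain ⟨s, hs, hs0⟩ := (hev.and (eventually_ge_atTop 0)).exists
    obtain ⟨z, hz, hzq⟩ := exists_inChamber_of_flow cs X _ hX q hderiv han
      ⟨x, Relation.ReflTransGen.refl, hq0 ▸ hxp⟩ s hs0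
    refine ⟨p, hp, ?_⟩
    rw [← hx _ hz, length_eq_card_of_inChamber cs σ hσ σW hσW z y (q s) hzq fun γ hγ h => ?_]
    · congr 1
      refine Finset.filter_congr fun γ hγ => ?_
      rw [(hs γ hγ).1, (hs _ (hTΦ γ hγ)).2]
    · have := hs γ hγ
      simp only [h, lt_irrefl, false_iff] at this
      exact hp γ hγ (le_antisymm (not_lt.mp this.1) (not_lt.mp this.2))
  obtain ⟨p, hp, e⟩ := key 1 (by simpa using h0)
  obtain ⟨p₁, hp₁, e₁⟩ := key x₁ h1
  have hrec : ∀ p γ, avgForm cs (u (T (T γ))) p + avgForm cs (u γ) p =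
      Λ γ * avgForm cs (u (T γ)) p := fun p γ => by
    rw [← LinearMap.add_apply, ← map_add, hu, map_smul, LinearMap.smul_apply, smul_eq_mul]
  have h := card_sign_changes_eq (rootSet cs) T (T.injective.injOn) hTΦ
    (fun γ => avgForm cs (u γ) p₁) (fun γ => avgForm cs (u γ) p) Λ hp₁ hp
    (fun γ _ => hrec p₁ γ) (fun γ _ => hrec p γ)
  rw [e₁, h, ← e]
  simp

end TwistedConjugacy

section Folding

variable {K : Type*} {N : CoxeterMatrix K} {G : Type*} [Group G]

/-- The homomorphism of Coxeter groups induced by a map of Dynkin diagrams preserving the labels. -/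
noncomputable def diagramHom (cs : CoxeterSystem M W) (cG : CoxeterSystem N G) (f : K → I)
    (hf : ∀ i j, M (f i) (f j) = N i j) : G →* W :=
  cG.lift ⟨fun k => cs.simple (f k), fun i j => by rw [← hf]; exact cs.simple_mul_simple_pow _ _⟩

variable (cs : CoxeterSystem M W) (cG : CoxeterSystem N G)
  {f : K → I} (hf : ∀ i j, M (f i) (f j) = N i j)
  {g : K → I} (hg : ∀ i j, M (g i) (g j) = N i j)

@[simp]
lemma diagramHom_simple (k : K) : diagramHom cs cG f hf (cG.simple k) = cs.simple (f k) :=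
  cG.lift_apply_simple _ k

@[simp]
lemma diagramHom_wordProd (ω : List K) :
    diagramHom cs cG f hf (cG.wordProd ω) = cs.wordProd (ω.map f) := by
  induction ω with
  | nil => simp
  | cons k ω ih => rw [cG.wordProd_cons, map_mul, ih, diagramHom_simple, List.map_cons,
      cs.wordProd_cons]

variable [Fintype I] [DecidableEq I] [Fintype K] [DecidableEq K]

/-- The linear map sending `α_k` to `α_{f k}`. -/
noncomputable def rootMap (f : K → I) : (K → ℝ) →ₗ[ℝ] (I → ℝ) :=
  ∑ k, (LinearMap.proj k).smulRight (simpleRoot (f k))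

omit [Fintype I] [DecidableEq K] in
lemma rootMap_apply (f : K → I) (v : K → ℝ) : rootMap f v = ∑ k, v k • simpleRoot (f k) := by
  simp [rootMap]

omit [Fintype I] in
lemma rootMap_simpleRoot (f : K → I) (k : K) :
    rootMap f (simpleRoot k) = simpleRoot (f k) := by
  rw [rootMap_apply, Finset.sum_eq_single k] <;> simp +contextual [simpleRoot]

omit [Fintype I] [DecidableEq K] in
lemma rootMap_nonneg (f : K → I) {v : K → ℝ} (hv : 0 ≤ v) : 0 ≤ rootMap f v := by
  rw [rootMap_apply]
  exact Finset.sum_nonneg fun k _ => smul_nonneg (hv k) (simpleRoot_nonneg _)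

include hf in
lemma form_rootMap (k : K) (v : K → ℝ) :
    form M (simpleRoot (f k)) (rootMap f v) = form N (simpleRoot k) v := by
  conv_rhs => rw [eq_sum_simpleRoot v]
  simp only [rootMap_apply, map_sum, map_smul, form_simpleRoot, hf]

lemma geomRep_diagramHom (c : G) (v : K → ℝ) :
    geomRep cs (diagramHom cs cG f hf c) (rootMap f v) = rootMap f (geomRep cG c v) := by
  induction c using cG.simple_induction_left generalizing v with
  | one => simp only [map_one]; rfl
  | mul_simple_left c k ih =>
    rw [map_mul, geomRep_mul_apply, ih, geomRep_mul_apply, diagramHom_simple, geomRep_simple,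
      geomRep_simple, form_rootMap hf, map_sub, map_smul, rootMap_simpleRoot]

lemma length_diagramHom (c : G) : cs.length (diagramHom cs cG f hf c) = cG.length c := by
  induction hn : cG.length c generalizing c with
  | zero => rw [cG.length_eq_zero_iff.mp hn, map_one, cs.length_one]
  | succ n ih =>
    have hc : c ≠ 1 := fun h => by simp [h] at hn
    obtain ⟨k, hk⟩ := cG.exists_rightDescent_of_ne_one hc
    rw [cG.isRightDescent_iff] at hk
    have h1 := ih (c * cG.simple k) (by omega)
    have h2 : 0 ≤ geomRep cG (c * cG.simple k) (simpleRoot k) :=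
      geomRep_simpleRoot_nonneg cG _ _ (by rw [cG.simple_mul_simple_cancel_right]; omega)
    have h3 := rootMap_nonneg f h2
    rw [← geomRep_diagramHom cs cG hf, rootMap_simpleRoot, ← length_lt_iff_nonneg, map_mul,
      diagramHom_simple, cs.simple_mul_simple_cancel_right] at h3
    rw [map_mul, diagramHom_simple] at h1
    have h4 := cs.length_mul_simple (diagramHom cs cG f hf c) (f k)
    omega

lemma diagramHom_injective : Function.Injective (diagramHom cs cG f hf) := by
  rw [injective_iff_map_eq_one]
  intro c hc
  rw [← cG.length_eq_zero_iff, ← length_diagramHom cs cG hf, hc, cs.length_one]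

end Folding

section DoubleCosets

variable {K : Type*} {N : CoxeterMatrix K} {G : Type*} [Group G]
  (cs : CoxeterSystem M W) (cG : CoxeterSystem N G)
  {f : K → I} (hf : ∀ i j, M (f i) (f j) = N i j)
  {g : K → I} (hg : ∀ i j, M (g i) (g j) = N i j)
  {d : W} (hd : ∀ a b, cs.length d ≤
    cs.length (diagramHom cs cG f hf a * d * diagramHom cs cG g hg b))

variable [Fintype I] [DecidableEq I]

include hd in
lemma exists_additive_words (α β : List K) :
    ∃ α' β' : List K, α'.Sublist α ∧
      cs.wordProd (α'.map f) * d * cs.wordProd (β'.map g) =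
        cs.wordProd (α.map f) * d * cs.wordProd (β.map g) ∧
      cs.length (cs.wordProd (α.map f) * d * cs.wordProd (β.map g)) =
        α'.length + cs.length d + β'.length := by
  obtain ⟨δ, hδ, rfl⟩ := cs.exists_isReduced d
  obtain ⟨τ, hτ, hτ', hr⟩ := exists_reduced_sublist cs (α.map f ++ δ ++ β.map g)
  obtain ⟨τ₁₂, τ₃, rfl, h12, h3⟩ := List.sublist_append_iff.mp hτ
  obtain ⟨τ₁, τ₂, rfl, h1, h2⟩ := List.sublist_append_iff.mp h12
  obtain ⟨α', hα, rfl⟩ := List.sublist_map_iff.mp h1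
  obtain ⟨β', hβ, rfl⟩ := List.sublist_map_iff.mp h3
  simp only [cs.wordProd_append] at hτ'
  have h := hd ((cG.wordProd α')⁻¹ * cG.wordProd α) (cG.wordProd β * (cG.wordProd β')⁻¹)
  simp only [map_mul, map_inv, diagramHom_wordProd] at h
  have e : (cs.wordProd (α'.map f))⁻¹ * cs.wordProd (α.map f) * cs.wordProd δ *
      (cs.wordProd (β.map g) * (cs.wordProd (β'.map g))⁻¹) = cs.wordProd τ₂ := by
    calc _ = (cs.wordProd (α'.map f))⁻¹ * (cs.wordProd (α.map f) * cs.wordProd δ *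
          cs.wordProd (β.map g)) * (cs.wordProd (β'.map g))⁻¹ := by group
      _ = _ := by rw [← hτ']; group
  rw [e, hδ.eq] at h
  have h2' : τ₂ = δ := h2.eq_of_length_le (h.trans (cs.length_wordProd_le _))
  subst h2'
  refine ⟨α', β', hα, hτ', ?_⟩
  have := hr.eq
  simp only [cs.wordProd_append, hτ'] at this
  rw [this, hδ.eq]
  simp [add_assoc]

variable [Fintype K] [DecidableEq K]

lemma length_le_of_diagramHom_eq {b : G} {β : List K}
    (h : cs.wordProd (β.map g) = diagramHom cs cG g hg b) : cG.length b ≤ β.length := by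
  rw [← length_diagramHom cs cG hg, ← h]
  simpa using cs.length_wordProd_le (β.map g)

include hd in
lemma length_mul_diagramHom (b : G) :
    cs.length (d * diagramHom cs cG g hg b) = cs.length d + cG.length b := by
  refine le_antisymm ((cs.length_mul_le _ _).trans_eq (by rw [length_diagramHom])) ?_
  obtain ⟨β, rfl⟩ := cG.wordProd_surjective b
  obtain ⟨α', β', hα, h1, h2⟩ := exists_additive_words cs cG hf hg hd [] β
  obtain rfl := List.sublist_nil.mp hα
  simp only [List.map_nil, cs.wordProd_nil, one_mul, mul_right_inj, List.length_nil,
    zero_add] at h1 h2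
  rw [diagramHom_wordProd, h2]
  exact Nat.add_le_add_left (length_le_of_diagramHom_eq cs cG hg (by rw [h1]; simp)) _

include hd in
lemma length_diagramHom_mul (a : G) :
    cs.length (diagramHom cs cG f hf a * d) = cG.length a + cs.length d := by
  have h := length_mul_diagramHom cs cG hg hf (d := d⁻¹) (fun a b => by
    rw [cs.length_inv]
    refine (hd b⁻¹ a⁻¹).trans_eq ?_
    rw [← cs.length_inv]
    simp [mul_assoc]) a⁻¹
  rw [cs.length_inv, cG.length_inv, map_inv, ← mul_inv_rev, cs.length_inv] at h
  rw [h, add_comm]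

include hd in
/-- Elements `a` of a parabolic subgroup with `a d ∈ d W_J` lie in the parabolic subgroup generated
by the simple reflections with this property. -/
theorem exists_word_of_mul_eq_mul (S : Set K)
    (hS : ∀ k k', cs.simple (f k) * d = d * cs.simple (g k') → k ∈ S) (c b : G)
    (h : diagramHom cs cG f hf c * d = d * diagramHom cs cG g hg b) :
    ∃ ω : List S, cG.wordProd (ω.map Subtype.val) = c := by
  induction hn : cG.length c generalizing c b with
  | zero => exact ⟨[], by simp [cG.length_eq_zero_iff.mp hn]⟩
  | succ n ih =>
    have hc : c ≠ 1 := fun h => by simp [h] at hn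
    obtain ⟨k, hk⟩ := cG.exists_leftDescent_of_ne_one hc
    rw [cG.isLeftDescent_iff] at hk
    set c' := cG.simple k * c with hc'
    have hcc' : c = cG.simple k * c' := by rw [hc', cG.simple_mul_simple_cancel_left]
    have hbc : cG.length b = cG.length c := by
      have h1 := congrArg cs.length h
      rw [length_mul_diagramHom cs cG hf hg hd, length_diagramHom_mul cs cG hf hg hd] at h1
      omega
    obtain ⟨β, rfl⟩ := cG.wordProd_surjective b
    obtain ⟨α', β', hα, h1, h2⟩ := exists_additive_words cs cG hf hg hd [k] β
    have e : cs.wordProd ([k].map f) * d * cs.wordProd (β.map g) =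
        diagramHom cs cG f hf c' * d := by
      rw [hc', map_mul, mul_assoc (diagramHom cs cG f hf _), h]
      simp [mul_assoc]
    rw [e, length_diagramHom_mul cs cG hf hg hd] at h2
    rw [e] at h1
    rcases List.sublist_cons_iff.mp hα with hα | ⟨r, rfl, hr⟩
    · obtain rfl := List.sublist_nil.mp hα
      simp only [List.map_nil, cs.wordProd_nil, one_mul] at h1
      rw [← diagramHom_wordProd cs cG hg] at h1
      obtain ⟨ω, hω⟩ := ih c' _ h1.symm (by omega)
      have h3 : cs.simple (f k) * d =
          d * diagramHom cs cG g hg (cG.wordProd β * (cG.wordProd β')⁻¹) := by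
        rw [map_mul, ← mul_assoc, ← h, map_inv, eq_mul_inv_iff_mul_eq, mul_assoc, h1, hc',
          map_mul, diagramHom_simple, mul_assoc, cs.simple_mul_simple_cancel_left]
      have h4 := length_diagramHom_mul cs cG hf hg hd (cG.simple k)
      rw [diagramHom_simple, h3, length_mul_diagramHom cs cG hf hg hd, cG.length_simple,
        add_comm, add_left_inj, cG.length_eq_one_iff] at h4
      obtain ⟨k', hk'⟩ := h4
      rw [hk', diagramHom_simple] at h3
      refine ⟨⟨k, hS k k' h3⟩ :: ω, ?_⟩
      rw [List.map_cons, cG.wordProd_cons, hω, hcc']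
    · obtain rfl := List.sublist_nil.mp hr
      have h3 : cs.wordProd (β'.map g) = diagramHom cs cG g hg (cG.wordProd β) := by
        rw [hc', map_mul, mul_assoc (diagramHom cs cG f hf _), h, diagramHom_simple] at h1
        simpa [mul_assoc] using h1
      have h4 := length_le_of_diagramHom_eq cs cG hg h3
      simp only [List.length_singleton] at h2
      omega

end DoubleCosets

section Rigidity

/-- Connected terminal elements have the same length. -/
def Rigid (cs : CoxeterSystem M W) {K : Type*} (f g : K → I) : Prop :=
  ∀ (y y' : W) (ω : List K), Terminal cs f g y → Terminal cs f g y' →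
    y' = cs.wordProd (ω.map f) * y * (cs.wordProd (ω.map g))⁻¹ → cs.length y' = cs.length y

lemma exists_word_of_reach (cs : CoxeterSystem M W) {K : Type*} {f g : K → I} {y y' : W}
    (h : Relation.ReflTransGen (shiftStep cs f g) y y') :
    ∃ ω : List K, y' = cs.wordProd (ω.map f) * y * (cs.wordProd (ω.map g))⁻¹ := by
  induction h with
  | refl => exact ⟨[], by simp⟩
  | tail _ h ih =>
    obtain ⟨ω, rfl⟩ := ih
    obtain ⟨k, rfl, -⟩ := h
    refine ⟨k :: ω, ?_⟩
    simp only [List.map_cons, cs.wordProd_cons, mul_inv_rev, cs.inv_simple, mul_assoc]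

lemma Terminal.of_reach {cs : CoxeterSystem M W} {K : Type*} {f g : K → I} {y y' : W}
    (hy : Terminal cs f g y) (h : Relation.ReflTransGen (shiftStep cs f g) y y') :
    Terminal cs f g y' := fun z hz => by
  rw [hy _ (h.trans hz), hy _ h]

lemma Terminal.reach_rotate {cs : CoxeterSystem M W} {K : Type*} {f g : K → I} (α : List K) (z : W)
    (hy : Terminal cs f g (cs.wordProd (α.map f) * z))
    (hl : cs.length (cs.wordProd (α.map f) * z) = α.length + cs.length z) :
    Relation.ReflTransGen (shiftStep cs f g) (cs.wordProd (α.map f) * z)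
      (z * cs.wordProd (α.map g)) := by
  induction α generalizing z with
  | nil => simpa using Relation.ReflTransGen.refl
  | cons k α ih =>
    have h1 : cs.length (cs.wordProd (α.map f) * (z * cs.simple (g k))) ≤
        α.length + (cs.length z + 1) := by
      refine (cs.length_mul_le _ _).trans (add_le_add ?_ ?_)
      · simpa using cs.length_wordProd_le (α.map f)
      · exact (cs.length_mul_le _ _).trans_eq (by rw [cs.length_simple])
    have hstep : shiftStep cs f g (cs.wordProd ((k :: α).map f) * z)
        (cs.wordProd (α.map f) * (z * cs.simple (g k))) := by
      refine ⟨k, ?_, ?_⟩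
      · simp [cs.wordProd_cons, mul_assoc]
      · rw [hl, List.length_cons]
        omega
    have h2 := hy _ (Relation.ReflTransGen.single hstep)
    rw [hl, List.length_cons] at h2
    have h3 : cs.length (cs.wordProd (α.map f) * (z * cs.simple (g k))) ≤
        α.length + cs.length (z * cs.simple (g k)) := by
      refine (cs.length_mul_le _ _).trans (Nat.add_le_add_right ?_ _)
      simpa using cs.length_wordProd_le (α.map f)
    have h4 := cs.length_mul_simple z (g k)
    have h5 := ih (z * cs.simple (g k)) (hy.of_reach (Relation.ReflTransGen.single hstep))
      (by omega)
    rw [List.map_cons (f := g), cs.wordProd_cons, ← mul_assoc]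
    exact Relation.ReflTransGen.head hstep h5

lemma coxeterMatrix_eq_of_form_eq {K : Type*} {N : CoxeterMatrix K} [Fintype I] [DecidableEq I]
    [Fintype K] [DecidableEq K] {i j : I} {k l : K}
    (h : form M (simpleRoot i) (simpleRoot j) = form N (simpleRoot k) (simpleRoot l)) :
    M i j = N k l := by
  rw [form_simpleRoot, form_simpleRoot, neg_inj] at h
  have hmem : ∀ m : ℕ, Real.pi / m ∈ Set.Icc 0 Real.pi := fun m => by
    refine ⟨by positivity, ?_⟩
    rcases Nat.eq_zero_or_pos m with rfl | hm
    · simpa using Real.pi_pos.le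
    · exact div_le_self Real.pi_pos.le (by exact_mod_cast hm)
  have h2 := Real.injOn_cos (hmem _) (hmem _) h
  rw [div_eq_mul_inv, div_eq_mul_inv, mul_right_inj' Real.pi_ne_zero, inv_inj] at h2
  exact_mod_cast h2

/-- Rigidity when all simple reflections are available. -/
lemma rigid_of_equiv [Fintype I] [DecidableEq I] [Finite W] (cs : CoxeterSystem M W)
    {K : Type*} (f : K → I) (e : K ≃ I) (hfe : ∀ i j, M (f i) (f j) = M (e i) (e j)) :
    Rigid cs f e := by
  have : Fintype W := Fintype.ofFinite W
  have hf : Function.Injective f := fun i j hij => by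
    by_contra hne
    have := hfe i j
    rw [hij, M.diagonal] at this
    exact M.off_diagonal _ _ (fun h => hne (e.injective h)) this.symm
  let σ : I ≃ I := Equiv.ofBijective (f ∘ e.symm)
    (Finite.injective_iff_bijective.mp (hf.comp e.symm.injective))
  have hσe : ∀ k, σ (e k) = f k := fun k => by simp [σ]
  have hσ : ∀ i j, M (σ i) (σ j) = M i j := fun i j => by
    obtain ⟨k, rfl⟩ := e.surjective i
    obtain ⟨l, rfl⟩ := e.surjective j
    rw [hσe, hσe, hfe]
  let σW : W ≃* W := MulEquiv.ofBijective (diagramHom cs cs σ hσ)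
    (Finite.injective_iff_bijective.mp (diagramHom_injective cs cs hσ))
  have hσW : ∀ i, σW (cs.simple i) = cs.simple (σ i) := fun i => diagramHom_simple cs cs hσ i
  have hstep : shiftStep cs f e = shiftStep cs σ id := by
    ext y y'
    refine ⟨fun ⟨k, h⟩ => ⟨e k, by rwa [hσe]⟩, fun ⟨i, h⟩ => ⟨e.symm i, ?_⟩⟩
    rwa [← hσe, e.apply_symm_apply]
  have hterm : ∀ y, Terminal cs f e y ↔ Terminal cs σ id y := fun y => by
    rw [Terminal, Terminal, hstep]
  rintro y y' ω hy hy' rfl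
  have e1 : cs.wordProd (ω.map f) = σW (cs.wordProd (ω.map e))⁻¹⁻¹ := by
    rw [inv_inv]
    refine Eq.trans ?_ (diagramHom_wordProd cs cs hσ _).symm
    rw [List.map_map]
    congr 2
    exact funext fun k => (hσe k).symm
  rw [e1] at hy' ⊢
  exact length_eq_of_terminal_of_conj cs σ hσ σW hσW y _ ((hterm _).mp hy) ((hterm _).mp hy')

variable {K : Type*} {N : CoxeterMatrix K} {G : Type*} [Group G]

/-- Rigidity for a twisted action of a Coxeter group reduces to rigidity for its parabolic
subgroups. -/
theorem rigid_of_forall_rigid [Fintype I] [DecidableEq I] [Fintype K] [DecidableEq K]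
    (cs : CoxeterSystem M W) (cG : CoxeterSystem N G)
    {f : K → I} (hf : ∀ i j, M (f i) (f j) = N i j)
    {g : K → I} (hg : ∀ i j, M (g i) (g j) = N i j)
    (h : ∀ (S : Set K) (φ : S → K), (∀ i j, N (φ i) (φ j) = N i j) →
      Rigid cG φ Subtype.val) :
    Rigid cs f g := by
  rintro y y' ω hy hy' rfl
  set F := diagramHom cs cG f hf with hF
  set H := diagramHom cs cG g hg with hH
  obtain ⟨a₀, b₀, hmin⟩ : ∃ a₀ b₀, ∀ a b, cs.length (F a₀ * y * H b₀) ≤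
      cs.length (F a * y * H b) :=
    ⟨_, _, fun a b => Function.argmin_le (fun p : G × G => cs.length (F p.1 * y * H p.2)) (a, b)⟩
  set d := F a₀ * y * H b₀ with hd_def
  have hd : ∀ a b, cs.length d ≤ cs.length (F a * d * H b) := fun a b => by
    refine (hmin (a * a₀) (b₀ * b)).trans_eq ?_
    simp only [hd_def, map_mul, mul_assoc]
  have key : ∀ z a b, Terminal cs f g z → z = F a * d * H b →
      ∃ x, Relation.ReflTransGen (shiftStep cs f g) z (d * H x) := by
    rintro z a b hz rfl
    obtain ⟨α, rfl⟩ := cG.wordProd_surjective a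
    obtain ⟨β, rfl⟩ := cG.wordProd_surjective b
    rw [hF, hH, diagramHom_wordProd, diagramHom_wordProd] at hz ⊢
    obtain ⟨α', β', -, h1, h2⟩ := exists_additive_words cs cG hf hg hd α β
    rw [← h1] at hz h2 ⊢
    rw [mul_assoc _ d] at hz h2 ⊢
    refine ⟨cG.wordProd (β' ++ α'), ?_⟩
    rw [diagramHom_wordProd, List.map_append, cs.wordProd_append, ← mul_assoc d]
    refine hz.reach_rotate α' _ ?_
    have h3 := cs.length_mul_le (cs.wordProd (α'.map f)) (d * cs.wordProd (β'.map g))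
    have h4 := cs.length_mul_le d (cs.wordProd (β'.map g))
    have h5 := cs.length_wordProd_le (α'.map f)
    have h6 := cs.length_wordProd_le (β'.map g)
    rw [List.length_map] at h5 h6
    omega
  have hyd : y = F a₀⁻¹ * d * H b₀⁻¹ := by
    simp only [hd_def, map_inv]
    group
  obtain ⟨x₁, hx₁⟩ := key y a₀⁻¹ b₀⁻¹ hy hyd
  obtain ⟨x₂, hx₂⟩ := key _ (cG.wordProd ω * a₀⁻¹) (b₀⁻¹ * (cG.wordProd ω)⁻¹) hy' (by
    conv_lhs => rw [hyd]
    simp only [map_mul, map_inv, hF, hH, diagramHom_wordProd, mul_assoc])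
  rw [← hy _ hx₁, ← hy' _ hx₂]
  obtain ⟨c₁, hc₁⟩ := exists_word_of_reach cs hx₁
  obtain ⟨c₂, hc₂⟩ := exists_word_of_reach cs hx₂
  set c := cG.wordProd c₂ * cG.wordProd ω * (cG.wordProd c₁)⁻¹ with hc
  have hconn : F c * d = d * H (x₂ * c * x₁⁻¹) := by
    have e1 : F c * (d * H x₁) = d * H x₂ * H c := by
      rw [hc₁, hc₂, hc]
      simp only [map_mul, map_inv, hF, hH, diagramHom_wordProd]
      group
    clear_value c d
    calc F c * d = F c * (d * H x₁) * (H x₁)⁻¹ := by group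
      _ = d * H (x₂ * c * x₁⁻¹) := by
        rw [e1, map_mul, map_mul, map_inv]
        group
  let S : Set K := {k | ∃ k', cs.simple (f k) * d = d * cs.simple (g k')}
  choose φ hφ using fun k : S => k.2
  obtain ⟨τ, hτ⟩ := exists_word_of_mul_eq_mul cs cG hf hg hd S
    (fun k k' hk => ⟨k', hk⟩) c _ hconn
  have hroot : ∀ k : S, geomRep cs d (simpleRoot (g (φ k))) = simpleRoot (f k) := fun k => by
    have hlt : cs.length d < cs.length (d * cs.simple (g (φ k))) := by
      have := length_mul_diagramHom cs cG hf hg hd (cG.simple (φ k))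
      rw [diagramHom_simple, cG.length_simple] at this
      omega
    have hnn := geomRep_simpleRoot_nonneg cs _ _ hlt
    refine geomRep_eq_simpleRoot cs _ _ _ hnn ?_
    rw [hφ, geomRep_mul_apply, geomRep_simple_self, map_neg]
    exact neg_nonpos.mpr hnn
  have hφN : ∀ i j, N (φ i) (φ j) = N i j := fun i j => by
    rw [← hg (φ i) (φ j), ← hf i j]
    refine coxeterMatrix_eq_of_form_eq ?_
    rw [← form_geomRep cs d, hroot, hroot]
  have hword : ∀ τ : List S, F (cG.wordProd (τ.map Subtype.val)) * d =
      d * H (cG.wordProd (τ.map φ)) := fun τ => by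
    induction τ with
    | nil => simp
    | cons k τ ih =>
      rw [List.map_cons, List.map_cons, cG.wordProd_cons, cG.wordProd_cons, map_mul, mul_assoc, ih,
        map_mul, hF, hH, diagramHom_simple, diagramHom_simple, ← mul_assoc, hφ, mul_assoc]
  have hx : x₂ = cG.wordProd (τ.map φ) * x₁ * (cG.wordProd (τ.map Subtype.val))⁻¹ := by
    have h1 := hword τ
    rw [hτ, hconn, mul_right_inj] at h1
    rw [← diagramHom_injective cs cG hg h1, hτ]
    group
  have hlen : ∀ x, cs.length (d * H x) = cs.length d + cG.length x :=
    length_mul_diagramHom cs cG hf hg hd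
  have hterm : ∀ x, Terminal cs f g (d * H x) → Terminal cG φ Subtype.val x := by
    intro x hx x' hxx'
    have h1 : Relation.ReflTransGen (shiftStep cs f g) (d * H x) (d * H x') := by
      refine Relation.ReflTransGen.lift (fun x => d * H x) (fun a b hab => ?_) _ _ hxx'
      obtain ⟨k, rfl, hk⟩ := hab
      refine ⟨k, ?_, ?_⟩
      · dsimp only
        rw [map_mul H, map_mul H, hH, diagramHom_simple, diagramHom_simple, ← mul_assoc,
          ← mul_assoc,
          ← mul_assoc, hφ]
      · dsimp only
        rw [hlen, hlen]
        exact Nat.add_le_add_left hk _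
    have h2 := hx _ h1
    rw [hlen, hlen] at h2
    omega
  rw [hlen, hlen, h S φ hφN x₁ x₂ τ (hterm _ (hy.of_reach hx₁)) (hterm _ (hy'.of_reach hx₂)) hx]

/-- The Coxeter matrix of a standard parabolic subgroup. -/
def restrictMatrix (N : CoxeterMatrix K) (S : Set K) : CoxeterMatrix S where
  M := Matrix.of fun i j => N i j
  isSymm := Matrix.IsSymm.ext fun _ _ => N.symmetric _ _
  diagonal _ := N.diagonal _
  off_diagonal _ _ h := N.off_diagonal _ _ (Subtype.coe_injective.ne h)

lemma restrictMatrix_apply (N : CoxeterMatrix K) (S : Set K) (i j : S) :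
    N i j = restrictMatrix N S i j := rfl

/-- Rigidity for all partial diagram automorphisms of a finite Coxeter group. -/
theorem rigid_toCoxeterSystem {K : Type*} [Fintype K] [DecidableEq K] (N : CoxeterMatrix K)
    [Finite N.Group] (S : Set K) (φ : S → K) (hφ : ∀ i j, N (φ i) (φ j) = N i j) :
    Rigid N.toCoxeterSystem φ Subtype.val := by
  classical
  induction hn : Fintype.card K using Nat.strong_induction_on generalizing K with
  | _ n ih =>
    by_cases hS : S = Set.univ
    · subst hS
      exact rigid_of_equiv N.toCoxeterSystem φ (Equiv.Set.univ K) hφ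
    · subst hn
      have : Finite (restrictMatrix N S).Group := Finite.of_injective _
        (diagramHom_injective N.toCoxeterSystem (restrictMatrix N S).toCoxeterSystem
          (restrictMatrix_apply N S))
      refine rigid_of_forall_rigid N.toCoxeterSystem (restrictMatrix N S).toCoxeterSystem hφ
        (restrictMatrix_apply N S)
        fun S' φ' hφ'' => ih (Fintype.card S) ?_ (restrictMatrix N S) S' φ' hφ'' rfl
      obtain ⟨k, hk⟩ := (Set.ne_univ_iff_exists_notMem S).mp hS
      exact Fintype.card_subtype_lt (p := (· ∈ S)) (x := k) hk

/-- Rigidity for the twisted action of a parabolic subgroup of a finite Coxeter group. -/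
theorem rigid_subtype [Fintype I] [DecidableEq I] [Finite W] (cs : CoxeterSystem M W) (J : Set I)
    (f : J → I) (hf : ∀ i j, M (f i) (f j) = M i j) : Rigid cs f Subtype.val := by
  classical
  have : Finite (restrictMatrix M J).Group := Finite.of_injective _
    (diagramHom_injective cs (restrictMatrix M J).toCoxeterSystem (restrictMatrix_apply M J))
  exact rigid_of_forall_rigid cs (restrictMatrix M J).toCoxeterSystem hf
    (restrictMatrix_apply M J) fun S φ hφ => rigid_toCoxeterSystem (restrictMatrix M J) S φ hφ

end Rigidity

section Orbits

lemma length_le_of_reach (cs : CoxeterSystem M W) {K : Type*} {f g : K → I} {y y' : W}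
    (h : Relation.ReflTransGen (shiftStep cs f g) y y') : cs.length y' ≤ cs.length y := by
  induction h with
  | refl => exact le_rfl
  | tail _ h ih =>
    obtain ⟨k, -, h⟩ := h
    exact h.trans ih

lemma exists_reach_terminal (cs : CoxeterSystem M W) {K : Type*} (f g : K → I) (y : W) :
    ∃ y', Relation.ReflTransGen (shiftStep cs f g) y y' ∧ Terminal cs f g y' := by
  induction hn : cs.length y using Nat.strong_induction_on generalizing y with
  | _ n ih =>
    by_cases hy : Terminal cs f g y
    · exact ⟨y, .refl, hy⟩
    · simp only [Terminal, not_forall] at hy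
      obtain ⟨z, hz, hlt⟩ := hy
      have hle := length_le_of_reach cs hz
      obtain ⟨y', h1, h2⟩ := ih _ (by omega) z rfl
      exact ⟨y', hz.trans h1, h2⟩

lemma exists_word_of_mem_parabolic (cs : CoxeterSystem M W) {J : Set I} {x : W}
    (hx : x ∈ parabolic cs J) : ∃ ω : List J, cs.wordProd (ω.map Subtype.val) = x := by
  induction hx using Subgroup.closure_induction with
  | mem x hx =>
    obtain ⟨j, hj, rfl⟩ := hx
    exact ⟨[⟨j, hj⟩], by simp⟩
  | one => exact ⟨[], by simp⟩
  | mul x y _ _ hx hy =>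
    obtain ⟨α, rfl⟩ := hx
    obtain ⟨β, rfl⟩ := hy
    exact ⟨α ++ β, by rw [List.map_append, cs.wordProd_append]⟩
  | inv x _ hx =>
    obtain ⟨α, rfl⟩ := hx
    exact ⟨α.reverse, by rw [List.map_reverse, cs.wordProd_reverse]⟩

lemma wordProd_mem_parabolic (cs : CoxeterSystem M W) {J : Set I} (ω : List J) :
    cs.wordProd (ω.map Subtype.val) ∈ parabolic cs J := by
  induction ω with
  | nil => simp [one_mem]
  | cons j ω ih =>
    rw [List.map_cons, cs.wordProd_cons]
    exact mul_mem (Subgroup.subset_closure ⟨j, j.2, rfl⟩) ih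

lemma map_wordProd (cs : CoxeterSystem M W) {δ : I ≃ I} {δW : W ≃* W}
    (hδW : ∀ i, δW (cs.simple i) = cs.simple (δ i)) (ω : List I) :
    δW (cs.wordProd ω) = cs.wordProd (ω.map δ) := by
  induction ω with
  | nil => simp
  | cons i ω ih => rw [List.map_cons, cs.wordProd_cons, cs.wordProd_cons, map_mul, hδW, ih]

lemma orbit_eq_of_mem {cs : CoxeterSystem M W} {J : Set I} {δW : W ≃* W} {v w : W}
    (hv : v ∈ orbit cs J δW w) : orbit cs J δW w = orbit cs J δW v := by
  obtain ⟨x, hx, rfl⟩ := hv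
  ext u
  constructor
  · rintro ⟨z, hz, rfl⟩
    refine ⟨z * x⁻¹, mul_mem hz (inv_mem hx), ?_⟩
    simp only [map_mul, map_inv]
    group
  · rintro ⟨z, hz, rfl⟩
    refine ⟨z * x, mul_mem hz hx, ?_⟩
    simp only [map_mul]
    group

lemma mem_orbit_iff (cs : CoxeterSystem M W) {J : Set I} {δ : I ≃ I} {δW : W ≃* W}
    (hδW : ∀ i, δW (cs.simple i) = cs.simple (δ i)) (w u : W) :
    u ∈ orbit cs J δW w ↔ ∃ ω : List J, u = cs.wordProd (ω.map fun j : J => δ j) * w *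
      (cs.wordProd (ω.map Subtype.val))⁻¹ := by
  have h : ∀ ω : List J, δW (cs.wordProd (ω.map Subtype.val)) =
      cs.wordProd (ω.map fun j : J => δ j) := fun ω => by
    rw [map_wordProd cs hδW, List.map_map]
    rfl
  constructor
  · rintro ⟨x, hx, rfl⟩
    obtain ⟨ω, rfl⟩ := exists_word_of_mem_parabolic cs hx
    exact ⟨ω, by rw [h]⟩
  · rintro ⟨ω, rfl⟩
    exact ⟨_, wordProd_mem_parabolic cs ω, by rw [h]⟩

/-- Bruhat comparison propagates backwards along length-decreasing cyclic shifts, up to replacing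
the smaller element by another one reached by such shifts. -/
lemma exists_bruhatLE_of_reach [Fintype I] [DecidableEq I] (cs : CoxeterSystem M W)
    {K : Type*} {f g : K → I} {v z : W}
    (h : Relation.ReflTransGen (shiftStep cs f g) v z) :
    ∃ u, Relation.ReflTransGen (shiftStep cs f g) z u ∧ bruhatLE cs u v := by
  induction h using Relation.ReflTransGen.head_induction_on with
  | refl =>
    obtain ⟨ω, hω, rfl⟩ := cs.exists_isReduced z
    exact ⟨_, .refl, ω, rfl, hω, ω, List.Sublist.refl _, rfl, hω⟩
  | head h _ ih =>
    obtain ⟨k, rfl, hk⟩ := h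
    obtain ⟨u, hu, hle⟩ := ih
    rcases bruhatLE_transfer cs (f k) (g k) _ u hk hle with h1 | ⟨h1, h2⟩
    · exact ⟨u, hu, h1⟩
    · exact ⟨_, hu.tail ⟨k, rfl, h2⟩, h1⟩

lemma bruhatLE.eq_of_length_le {cs : CoxeterSystem M W} {u v : W} (h : bruhatLE cs u v)
    (hl : cs.length v ≤ cs.length u) : u = v := by
  obtain ⟨ω, rfl, hω, ω', hs, rfl, hω'⟩ := h
  rw [hω, hω'] at hl
  rw [hs.eq_of_length_le hl]

end Orbits

/-- an element of a `W_J`-orbit is minimal for the Bruhat order restricted to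
the orbit if and only if it has minimal length in the orbit. -/
theorem bruhat_min_iff_length_min
    [Fintype I] [Finite W]
    (cs : CoxeterSystem M W) (J : Set I) (δ : I ≃ I)
    (hδM : ∀ i j : I, M (δ i) (δ j) = M i j)
    (δW : W ≃* W) (hδW : ∀ i : I, δW (cs.simple i) = cs.simple (δ i))
    (w v : W) (hv : v ∈ orbit cs J δW w) :
    (∀ u ∈ orbit cs J δW w, bruhatLE cs u v → u = v) ↔
      (∀ u ∈ orbit cs J δW w, cs.length v ≤ cs.length u) := by
  classical
  set f : J → I := fun j => δ j
  have hmem := fun w u => mem_orbit_iff cs (J := J) hδW w u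
  have hreach : ∀ {y y'}, Relation.ReflTransGen (shiftStep cs f Subtype.val) y y' →
      y' ∈ orbit cs J δW y := fun h => (hmem _ _).mpr (exists_word_of_reach cs h)
  rw [orbit_eq_of_mem hv]
  constructor
  · intro hmin
    obtain ⟨z, hvz, hz⟩ := exists_reach_terminal cs f Subtype.val v
    obtain ⟨u, hzu, huv⟩ := exists_bruhatLE_of_reach cs hvz
    obtain rfl := hmin u (hreach (hvz.trans hzu)) huv
    have hu := hz.of_reach hzu
    intro x hx
    obtain ⟨x', hxx', hx'⟩ := exists_reach_terminal cs f Subtype.val x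
    have h1 : x' ∈ orbit cs J δW u := by
      rw [orbit_eq_of_mem hx]
      exact hreach hxx'
    obtain ⟨ω, hω⟩ := (hmem _ _).mp h1
    rw [← rigid_subtype cs J f (fun i j => hδM i j) u x' ω hu hx' hω]
    exact length_le_of_reach cs hxx'
  · exact fun hmin u hu hle => hle.eq_of_length_le (hmin u hu)

end HePaper
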